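/- Let (R,m) be a Noetherian local ring of dimension d such that R̂ is reduced, and let B be a balanced big Cohen–Macaulay R-algebra satisfying condition (†). If R is Cohen–Macaulay and e₁^B(Q) = 0 for some parameter ideal Q ⊆ R, then Q^B = Q and R is BCM_B-rational (in particular the natural map H^d_m(R) → H^d_m(B) is injective). -/

import Mathlib

open IsLocalRing

universe u

section BasicDefs

variable (R : Type*) [CommRing R]

/-- The length of a module, i.e. the Krull dimension of its lattice of submodules. -/
noncomputable def moduleLength (M : Type*) [AddCommGroup M] [Module R M] : WithBot ℕ∞ :=
  Order.krullDim (Submodule R M)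

/-- A system of parameters of a Noetherian local ring: `d` elements generating an
ideal whose radical is the maximal ideal, where `d` is the Krull dimension. -/
def IsSOP [IsLocalRing R] {d : ℕ} (x : Fin d → R) : Prop :=
  ringKrullDim R = (d : WithBot ℕ∞) ∧
    (Ideal.span (Set.range x)).radical = maximalIdeal R

/-- A parameter ideal is an ideal generated by a system of parameters. -/
def IsParameterIdeal [IsLocalRing R] (Q : Ideal R) : Prop :=
  ∃ (d : ℕ) (x : Fin d → R), IsSOP R x ∧ Q = Ideal.span (Set.range x)

/-- `f : R →+* B` makes `B` a balanced big Cohen-Macaulay `R`-algebra if every system of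
parameters of `R` maps to a regular sequence on `B` and `m·B ≠ B`. -/
def IsBalancedBigCMHom [IsLocalRing R] {B : Type*} [CommRing B] (f : R →+* B) : Prop :=
  (∀ (d : ℕ) (x : Fin d → R), IsSOP R x →
      RingTheory.Sequence.IsRegular B (List.ofFn fun i => f (x i))) ∧
    (maximalIdeal R).map f ≠ ⊤

/-- A balanced big Cohen-Macaulay algebra. -/
def IsBalancedBigCM [IsLocalRing R] (B : Type*) [CommRing B] [Algebra R B] : Prop :=
  IsBalancedBigCMHom R (algebraMap R B)

/-- The integral closure of an ideal `I`, as a set: all `x` satisfying an equation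
`x^n + a₁ x^{n-1} + ⋯ + aₙ = 0` with `aₖ ∈ I^k`. -/
def intClSet (I : Ideal R) : Set R :=
  { x | ∃ n : ℕ, 0 < n ∧ ∃ a : ℕ → R,
      (∀ k ∈ Finset.Icc 1 n, a k ∈ I ^ k) ∧
      x ^ n + ∑ k ∈ Finset.Icc 1 n, a k * x ^ (n - k) = 0 }

/-- `I^B := IB ∩ R`, the contraction of the extension of `I` along `f : R →+* B`. -/
def contractedExt {B : Type*} [CommRing B] (f : R →+* B) (I : Ideal R) : Ideal R :=
  (I.map f).comap f

/-- Condition (†): `I^B ⊆ \bar I` for every m-primary ideal `I`. -/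
def SatisfiesDagger [IsLocalRing R] {B : Type*} [CommRing B] (f : R →+* B) : Prop :=
  ∀ I : Ideal R, I.radical = maximalIdeal R →
    (contractedExt R f I : Set R) ⊆ intClSet R I

/-- `e` is the family of Hilbert coefficients of the filtration `J` (in dimension `d`):
for `n ≫ 0`, `ℓ(R/J (n+1)) = ∑_{i≤d} (-1)^i e i * choose (n+d-i) (d-i)`. -/
def HasHilbertSeries (d : ℕ) (J : ℕ → Ideal R) (e : ℕ → ℤ) : Prop :=
  ∃ N : ℕ, ∀ n ≥ N, ∃ m : ℕ,
    moduleLength R (R ⧸ J (n + 1)) = (m : WithBot ℕ∞) ∧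
    (m : ℤ) = ∑ i ∈ Finset.range (d + 1),
      (-1) ^ i * e i * ((n + d - i).choose (d - i) : ℤ)

/-- Module version of `HasHilbertSeries`, for the `J`-adic filtration of a module `M`. -/
def HasHilbertSeriesMod (M : Type*) [AddCommGroup M] [Module R M] (d : ℕ)
    (J : Ideal R) (e : ℕ → ℤ) : Prop :=
  ∃ N : ℕ, ∀ n ≥ N, ∃ m : ℕ,
    moduleLength R (M ⧸ (J ^ (n + 1) • (⊤ : Submodule R M))) = (m : WithBot ℕ∞) ∧
    (m : ℤ) = ∑ i ∈ Finset.range (d + 1),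
      (-1) ^ i * e i * ((n + d - i).choose (d - i) : ℤ)


/-- The limit closure `(x₁,…,x_d)^{lim} = ⋃ₜ ((x₁^{t+1},…,x_d^{t+1}) : (x₁⋯x_d)^t)`. -/
def limitClosure {d : ℕ} (x : Fin d → R) : Ideal R :=
  ⨆ t : ℕ, (Ideal.span (Set.range fun i => x i ^ (t + 1))).colon
    (Ideal.span {(∏ i, x i) ^ t})

/-- A ring is equidimensional if `dim (R/P) = dim R` for every minimal prime `P`. -/
def IsEquidimensional : Prop :=
  ∀ P ∈ minimalPrimes R, ringKrullDim (R ⧸ P) = ringKrullDim R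

/-- Depth at least `n`: there is a regular sequence of length `n` in the
(Jacobson) radical, i.e. in the maximal ideal when `R` is local. -/
def HasDepthGE (n : ℕ) : Prop :=
  ∃ rs : List R, rs.length = n ∧ (∀ r ∈ rs, r ∈ (⊥ : Ideal R).jacobson) ∧
    RingTheory.Sequence.IsRegular R rs

/-- A Cohen-Macaulay (Noetherian) local ring: depth = dimension. -/
def IsCohenMacaulayLocalRing : Prop :=
  IsLocalRing R ∧ IsNoetherianRing R ∧
    ∃ d : ℕ, ringKrullDim R = (d : WithBot ℕ∞) ∧ HasDepthGE R d

/-- Serre's condition S₂: for every prime `P`,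
`depth R_P ≥ min 2 (dim R_P)`. -/
def SerreS2 : Prop :=
  ∀ (P : Ideal R) (hP : P.IsPrime) (n : ℕ),
    (n : WithBot ℕ∞) ≤ min 2 (ringKrullDim (Localization.AtPrime P)) →
    HasDepthGE (Localization.AtPrime P) n

/-- A regular local ring: a Noetherian local ring whose maximal ideal is generated
by `dim R` elements. -/
def IsRegularLocal : Prop :=
  IsLocalRing R ∧ IsNoetherianRing R ∧ ∃ (d : ℕ) (x : Fin d → R),
    ringKrullDim R = (d : WithBot ℕ∞) ∧
      Ideal.span (Set.range x) = (⊥ : Ideal R).jacobson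

/-- A regular (not necessarily local) ring: Noetherian and all localizations at
primes are regular local rings. -/
def IsRegularRingAux : Prop :=
  IsNoetherianRing R ∧
    ∀ (P : Ideal R) (hP : P.IsPrime), IsRegularLocal (Localization.AtPrime P)

/-- The tight closure of an ideal `I` in characteristic `p`, as a set. -/
def tightClSet (p : ℕ) (I : Ideal R) : Set R :=
  { x | ∃ c : R, (∀ P ∈ minimalPrimes R, c ∉ P) ∧
      ∃ E : ℕ, ∀ e ≥ E, c * x ^ p ^ e ∈ Ideal.span ((fun a => a ^ p ^ e) '' (I : Set R)) }

/-- F-rationality: every parameter ideal is tightly closed. -/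
def IsFRational [IsLocalRing R] (p : ℕ) : Prop :=
  ∀ Q : Ideal R, IsParameterIdeal R Q → tightClSet R p Q ⊆ (Q : Set R)

end BasicDefs

section Excellence

open TensorProduct

/-- Geometrically regular `k`-algebra (for `k` a field): `L ⊗[k] A` is regular
for every finite field extension `L` of `k`. -/
def IsGeometricallyRegular (k : Type u) (A : Type u) [CommRing k] [CommRing A]
    [Algebra k A] : Prop :=
  ∀ (L : Type u) [Field L] [Algebra k L], Module.Finite k L → IsRegularRingAux (L ⊗[k] A)

/-- `R` is a G-ring: for every prime `p`, the fibers of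
`R_p → (R_p)^∧` are geometrically regular. -/
def IsGRing (R : Type u) [CommRing R] : Prop :=
  ∀ (p : Ideal R) (hp : p.IsPrime) (q : Ideal (Localization.AtPrime p)) (hq : q.IsPrime),
    IsGeometricallyRegular
      (ResidueField (Localization.AtPrime q))
      ((ResidueField (Localization.AtPrime q))
        ⊗[Localization.AtPrime p]
        AdicCompletion (maximalIdeal (Localization.AtPrime p)) (Localization.AtPrime p))

/-- `R` is J-2: the regular locus of every finitely generated `R`-algebra is open. -/
def IsJ2 (R : Type u) [CommRing R] : Prop :=
  ∀ (A : Type u) [CommRing A] [Algebra R A], Algebra.FiniteType R A →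
    IsOpen { P : PrimeSpectrum A | IsRegularLocal (Localization.AtPrime P.asIdeal) }

/-- A catenary ring: any two saturated chains of primes with the same endpoints
have the same length. -/
def IsCatenary (A : Type*) [CommRing A] : Prop :=
  ∀ c₁ c₂ : LTSeries (PrimeSpectrum A),
    c₁.head = c₂.head → c₁.last = c₂.last →
    (∀ i : Fin c₁.length, c₁.toFun i.castSucc ⋖ c₁.toFun i.succ) →
    (∀ i : Fin c₂.length, c₂.toFun i.castSucc ⋖ c₂.toFun i.succ) →
    c₁.length = c₂.length

/-- Universally catenary: every finitely generated `R`-algebra is catenary. -/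
def IsUniversallyCatenary (R : Type u) [CommRing R] : Prop :=
  ∀ (A : Type u) [CommRing A] [Algebra R A], Algebra.FiniteType R A → IsCatenary A

/-- An excellent ring: Noetherian, a G-ring, J-2 and universally catenary. -/
def IsExcellentRing (R : Type u) [CommRing R] : Prop :=
  IsNoetherianRing R ∧ IsGRing R ∧ IsJ2 R ∧ IsUniversallyCatenary R

end Excellence

/-- `R` is BCM_B-rational (in dimension `d`): Cohen-Macaulay and the natural map
`H^d_m(R) → H^d_m(B)` is injective. -/
def IsBCMRational (R : Type u) [CommRing R] [IsLocalRing R]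
    (B : Type u) [CommRing B] [Algebra R B] (d : ℕ) : Prop :=
  IsCohenMacaulayLocalRing R ∧
    Function.Injective
      ((localCohomology (maximalIdeal R) d).map (ModuleCat.ofHom (Algebra.linearMap R B)))


section ExtPart
open CategoryTheory CategoryTheory.Abelian RingTheory.Sequence Pointwise

variable {R : Type u} [CommRing R]

lemma ext_smul_eq_zero {N M : ModuleCat.{u} R} {r : R} (hr : ∀ n : N, r • n = 0) {i : ℕ}
    (ξ : Abelian.Ext.{u} N M i) : ξ.comp (Ext.mk₀ (r • 𝟙 M)) (add_zero i) = 0 := by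
  rw [← Ext.smul_eq_comp_mk₀]
  have h : ξ = (Ext.mk₀ (𝟙 N)).comp ξ (zero_add i) := by simp
  rw [h, ← Ext.smul_comp, ← Ext.mk₀_smul]
  have : r • 𝟙 N = 0 := by
    ext n
    exact hr n
  rw [this]; simp

lemma ext_subsingleton_of_regular (rs : List R) :
    ∀ (N M : ModuleCat.{u} R), (∀ r ∈ rs, ∀ n : N, r • n = 0) → IsWeaklyRegular M rs →
    ∀ i < rs.length, ∀ ξ : Abelian.Ext.{u} N M i, ξ = 0 := by
  induction rs with
  | nil => intro N M _ _ i hi; simp at hi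
  | cons r rs ih =>
    intro N M hN hM i hi ξ
    rw [isWeaklyRegular_cons_iff] at hM
    have hS := hM.1.smulShortComplex_shortExact
    have h0 := ext_smul_eq_zero (hN r (by simp)) ξ
    cases i with
    | zero =>
      have hm := hS.mono_f
      have := Ext.postcomp_mk₀_injective_of_mono N (ModuleCat.smulShortComplex M r).f
      apply this
      exact h0.trans (map_zero _).symm
    | succ i =>
      obtain ⟨η, hη⟩ := Ext.covariant_sequence_exact₁ N hS ξ h0 rfl
      have : η = 0 := ih N (ModuleCat.of R (QuotSMulTop r M))
        (fun r' hr' => hN r' (by simp [hr'])) hM.2 i (by simpa using hi) η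
      rw [← hη, this]
      exact Ext.zero_comp ..

lemma mem_ofList_cons_smul_top_iff {M : Type*} [AddCommGroup M] [Module R M] (r : R) (rs : List R)
    (y : M) : y ∈ (Ideal.ofList (r :: rs) • ⊤ : Submodule R M) ↔
      (Submodule.Quotient.mk y : QuotSMulTop r M) ∈
        (Ideal.ofList rs • ⊤ : Submodule R (QuotSMulTop r M)) := by
  have h : (Ideal.ofList rs • ⊤ : Submodule R (QuotSMulTop r M)) =
      (Ideal.ofList rs • ⊤ : Submodule R M).map (Submodule.mkQ _) := by
    rw [Submodule.map_smul'', Submodule.map_top, Submodule.range_mkQ]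
  rw [h, Ideal.ofList_cons_smul]
  change _ ↔ (Submodule.mkQ (r • ⊤ : Submodule R M)) y ∈ _
  rw [← Submodule.mem_comap, Submodule.comap_map_mkQ]

lemma ext_injective_of_regular (rs : List R) :
    ∀ (N M M' : ModuleCat.{u} R) (φ : M ⟶ M'), (∀ r ∈ rs, ∀ n : N, r • n = 0) →
    IsWeaklyRegular M rs → IsWeaklyRegular M' rs →
    (∀ y : M, φ.hom y ∈ (Ideal.ofList rs • ⊤ : Submodule R M') →
      y ∈ (Ideal.ofList rs • ⊤ : Submodule R M)) →
    ∀ ξ : Abelian.Ext.{u} N M rs.length, ξ.comp (Ext.mk₀ φ) (add_zero _) = 0 → ξ = 0 := by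
  induction rs with
  | nil =>
    intro N M M' φ _ _ _ h ξ hξ
    have : Mono φ := by
      rw [ModuleCat.mono_iff_injective, injective_iff_map_eq_zero]
      intro a ha
      have := h a (by rw [show φ.hom a = 0 from ha]; exact zero_mem _)
      simpa using this
    apply Ext.postcomp_mk₀_injective_of_mono N φ
    rw [map_zero]
    exact hξ
  | cons r rs ih =>
    intro N M M' φ hN hM hM' h ξ hξ
    have hN' : ∀ r' ∈ rs, ∀ n : N, r' • n = 0 := fun r' hr' => hN r' (by simp [hr'])
    have hv := ext_subsingleton_of_regular (r :: rs) N M' hN hM' rs.length (by simp)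
    rw [isWeaklyRegular_cons_iff] at hM hM'
    have hS := hM.1.smulShortComplex_shortExact
    have hS' := hM'.1.smulShortComplex_shortExact
    have h0 := ext_smul_eq_zero (hN r (by simp)) ξ
    obtain ⟨η, hη⟩ := Ext.covariant_sequence_exact₁ N hS ξ h0 rfl
    let φ' : ModuleCat.of R (QuotSMulTop r M) ⟶ ModuleCat.of R (QuotSMulTop r M') :=
      ModuleCat.ofHom (QuotSMulTop.map r φ.hom)
    let F : ModuleCat.smulShortComplex M r ⟶ ModuleCat.smulShortComplex M' r :=
      { τ₁ := φ
        τ₂ := φ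
        τ₃ := φ'
        comm₁₂ := by ext y; exact (map_smul φ.hom r y).symm
        comm₂₃ := by ext y; simp [ModuleCat.smulShortComplex, φ'] ; rfl }
    have nat := ShortComplex.ShortExact.extClass_naturality hS hS' F
    have h1 : (η.comp (Ext.mk₀ φ') (add_zero _)).comp hS'.extClass rfl = 0 := by
      have e1 : (η.comp (Ext.mk₀ φ') (add_zero _)).comp hS'.extClass rfl =
        η.comp ((Ext.mk₀ F.τ₃).comp hS'.extClass (zero_add 1)) rfl :=
        Ext.comp_assoc_of_second_deg_zero _ _ _ _
      rw [e1, ← nat, ← Ext.comp_assoc_of_third_deg_zero, hη]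
      exact hξ
    obtain ⟨ζ, hζ⟩ := Ext.covariant_sequence_exact₃ N hS' _ rfl h1
    have h2 : η.comp (Ext.mk₀ φ') (add_zero _) = 0 := by
      have h5 : ζ = 0 := hv ζ
      rw [← hζ, h5]
      exact Ext.zero_comp ..
    have h3 : η = 0 := by
      refine ih N (ModuleCat.of R (QuotSMulTop r M)) (ModuleCat.of R (QuotSMulTop r M')) φ' hN'
        hM.2 hM'.2 ?_ η h2
      intro y hy
      obtain ⟨y, rfl⟩ := Submodule.Quotient.mk_surjective _ y
      rw [← mem_ofList_cons_smul_top_iff]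
      apply h
      rw [mem_ofList_cons_smul_top_iff]
      exact hy
    rw [← hη, h3]
    exact Ext.zero_comp ..

end ExtPart

section ExtPart2
open CategoryTheory CategoryTheory.Abelian RingTheory.Sequence Pointwise

variable {R : Type u} [CommRing R]

lemma ext_powers_of_regular (rs : List R) (M M' : ModuleCat.{u} R) (φ : M ⟶ M')
    (hM : IsWeaklyRegular M rs) (hM' : IsWeaklyRegular M' rs)
    (hφ : ∀ y : M, φ.hom y ∈ (Ideal.ofList rs • ⊤ : Submodule R M') →
      y ∈ (Ideal.ofList rs • ⊤ : Submodule R M)) (t : ℕ) :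
    ∀ (N : ModuleCat.{u} R), (∀ r ∈ Ideal.ofList rs ^ t, ∀ n : N, r • n = 0) →
      (∀ i < rs.length, ∀ ξ : Abelian.Ext.{u} N M' i, ξ = 0) ∧
      (∀ ξ : Abelian.Ext.{u} N M rs.length, ξ.comp (Ext.mk₀ φ) (add_zero _) = 0 → ξ = 0) := by
  induction t with
  | zero =>
    intro N hN
    have h1 : ∀ n : N, n = 0 := fun n => by simpa using hN 1 (by simp) n
    exact ⟨ext_subsingleton_of_regular rs N M' (fun r _ n => by rw [h1 n, smul_zero]) hM',
      ext_injective_of_regular rs N M M' φ (fun r _ n => by rw [h1 n, smul_zero]) hM hM' hφ⟩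
  | succ t ih =>
    intro N hN
    let K : Submodule R N := (Ideal.ofList rs ^ t • ⊤ : Submodule R N)
    let g : N →ₗ[R] (N ⧸ K) := K.mkQ
    have hS : g.shortComplexKer.ShortExact :=
      LinearMap.shortExact_shortComplexKer (Submodule.mkQ_surjective K)
    obtain ⟨v3, i3⟩ := ih (ModuleCat.of R (N ⧸ K)) (by
      intro r hr n
      obtain ⟨n, rfl⟩ := Submodule.Quotient.mk_surjective _ n
      rw [← Submodule.Quotient.mk_smul, Submodule.Quotient.mk_eq_zero]
      exact Submodule.smul_mem_smul hr trivial)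
    have hk : ∀ r ∈ rs, ∀ n : (ModuleCat.of R (LinearMap.ker g)), r • n = 0 := by
      rintro r hr ⟨n, hn⟩
      have hn' : n ∈ K := by simpa [g] using hn
      apply Subtype.ext
      change r • n = 0
      refine Submodule.smul_induction_on hn' ?_ ?_
      · intro a ha b _
        rw [← mul_smul]
        apply hN
        rw [pow_succ', ]
        exact Ideal.mul_mem_mul (Ideal.subset_span hr) ha
      · intro a b ha hb
        rw [smul_add, ha, hb, add_zero]
    have v1 := ext_subsingleton_of_regular rs (ModuleCat.of R (LinearMap.ker g)) M' hk hM'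
    have i1 := ext_injective_of_regular rs (ModuleCat.of R (LinearMap.ker g)) M M' φ hk hM hM' hφ
    constructor
    · intro i hi ξ
      obtain ⟨η, hη⟩ := Ext.contravariant_sequence_exact₂ hS M' ξ (v1 i hi _)
      have : η = 0 := v3 i hi η
      rw [← hη, this]
      exact Ext.comp_zero ..
    · intro ξ hξ
      have e1 := i1 ((Ext.mk₀ g.shortComplexKer.f).comp ξ (zero_add _)) (by
        have : ((Ext.mk₀ g.shortComplexKer.f).comp ξ (zero_add _)).comp (Ext.mk₀ φ) (add_zero _)
          = (Ext.mk₀ g.shortComplexKer.f).comp (ξ.comp (Ext.mk₀ φ) (add_zero _)) (zero_add _) := by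
          apply Ext.comp_assoc_of_third_deg_zero
        refine Eq.trans this ?_
        rw [hξ]
        exact Ext.comp_zero ..)
      obtain ⟨η, hη⟩ := Ext.contravariant_sequence_exact₂ hS M ξ e1
      have h2 : (Ext.mk₀ g.shortComplexKer.g).comp (η.comp (Ext.mk₀ φ) (add_zero _))
          (zero_add _) = 0 := by
        rw [← Ext.comp_assoc_of_third_deg_zero, hη]
        exact hξ
      have h3 : η.comp (Ext.mk₀ φ) (add_zero _) = 0 := by
        rcases Nat.eq_zero_or_pos rs.length with hl | hl
        · have key : ∀ (k : ℕ) (hk : k = 0) (a : Abelian.Ext.{u} g.shortComplexKer.X₃ M' k),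
              (Ext.mk₀ g.shortComplexKer.g).comp a (zero_add _) = 0 → a = 0 := by
            intro k hk a ha
            subst hk
            have := hS.epi_g
            apply Ext.precomp_mk₀_injective_of_epi M' g.shortComplexKer.g
            exact ha.trans (map_zero _).symm
          exact key _ hl _ h2
        · obtain ⟨ζ, hζ⟩ := Ext.contravariant_sequence_exact₃ hS M' _ h2
            (n₀ := rs.length - 1) (by omega)
          have : ζ = 0 := v1 _ (by omega) ζ
          rw [← hζ, this]
          exact Ext.comp_zero ..
      have : η = 0 := i3 η h3
      rw [← hη, this]
      exact Ext.comp_zero ..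


lemma mono_homologyMap_of_elements {K L : CochainComplex (ModuleCat.{u} R) ℕ} (f : K ⟶ L) (n : ℕ)
    (h : ∀ x : K.X n, K.d n (n + 1) x = 0 →
      ∀ y : L.X ((ComplexShape.up ℕ).prev n), f.f n x = L.d _ n y →
      ∃ w : K.X ((ComplexShape.up ℕ).prev n), K.d _ n w = x) :
    Mono (HomologicalComplex.homologyMap f n) := by
  rw [ModuleCat.mono_iff_injective, injective_iff_map_eq_zero]
  intro z hz
  obtain ⟨c, rfl⟩ := (ModuleCat.epi_iff_surjective (K.homologyπ n)).1 inferInstance z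
  have e1 := ConcreteCategory.congr_hom (HomologicalComplex.homologyπ_naturality f n) c
  rw [ConcreteCategory.comp_apply, ConcreteCategory.comp_apply] at e1
  have e2 : (L.homologyπ n) (HomologicalComplex.cyclesMap f n c) = 0 := by
    rw [← e1]; exact hz
  have ex := ShortComplex.exact_of_g_is_cokernel (.mk _ _ (L.toCycles_comp_homologyπ _ n))
    (L.homologyIsCokernel _ n rfl)
  rw [ShortComplex.moduleCat_exact_iff] at ex
  obtain ⟨y, hy⟩ := ex _ e2
  have hci : K.d n (n+1) (K.iCycles n c) = 0 := by
    rw [← ConcreteCategory.comp_apply, K.iCycles_d]; rfl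
  obtain ⟨w, hw⟩ := h (K.iCycles n c) hci y (by
    have e3 := ConcreteCategory.congr_hom (HomologicalComplex.cyclesMap_i f n) c
    have e4 := ConcreteCategory.congr_hom (L.toCycles_i ((ComplexShape.up ℕ).prev n) n) y
    rw [ConcreteCategory.comp_apply] at e3 e4
    rw [ConcreteCategory.comp_apply] at e3
    rw [← e3, ← e4]
    exact congrArg _ hy.symm)
  have hc : K.toCycles _ n w = c := by
    apply (ModuleCat.mono_iff_injective (K.iCycles n)).1 inferInstance
    have e4 := ConcreteCategory.congr_hom (K.toCycles_i ((ComplexShape.up ℕ).prev n) n) w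
    rw [ConcreteCategory.comp_apply] at e4
    rw [e4, hw]
  rw [← hc]
  rw [← ConcreteCategory.comp_apply, K.toCycles_comp_homologyπ]; rfl

def linearYonedaObjMap (P : ChainComplex (ModuleCat.{u} R) ℕ) {Y Y' : ModuleCat.{u} R} (φ : Y ⟶ Y') :
    P.linearYonedaObj R Y ⟶ P.linearYonedaObj R Y' where
  f i := ((linearYoneda R (ModuleCat.{u} R)).map φ).app (Opposite.op (P.X i))
  comm' i j hij := by
    ext x
    exact (Category.assoc (P.d j i) (show P.X i ⟶ Y from x) φ).symm

lemma epi_of_iso_square {C : Type*} [Category C] {A A' D D' : C} (f : A ⟶ D) (i : D ≅ D')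
    (j : A ≅ A') (g : A' ⟶ D') (h : f ≫ i.hom = j.hom ≫ g) (hg : Epi g) : Epi f := by
  rw [← Iso.eq_comp_inv] at h
  rw [h]
  infer_instance

lemma oldExt_map_mono (X Y Y' : ModuleCat.{u} R) (φ : Y ⟶ Y') (n : ℕ)
    (h : ∀ ξ : Abelian.Ext.{u} X Y n, ξ.comp (Ext.mk₀ φ) (add_zero _) = 0 → ξ = 0) :
    Mono (((_root_.Ext R (ModuleCat.{u} R) n).obj (Opposite.op X)).map φ) := by
  let P := ProjectiveResolution.of X
  have hmono : Mono (HomologicalComplex.homologyMap (linearYonedaObjMap P.complex φ) n) := by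
    apply mono_homologyMap_of_elements
    intro (x : P.complex.X n ⟶ Y) (hx : P.complex.d (n + 1) n ≫ x = 0)
      (y : P.complex.X _ ⟶ Y') (hy : x ≫ φ = P.complex.d n _ ≫ y)
    change ∃ w : P.complex.X _ ⟶ Y, P.complex.d n _ ≫ w = x
    rcases n with _ | n
    · have hp : (ComplexShape.up ℕ).prev 0 = 0 := by simp
      have hd : ∀ k, k = 0 → P.complex.d 0 k = 0 := by
        intro k hk; apply P.complex.shape; simp [hk]
      rw [hd _ hp] at hy ⊢
      refine ⟨0, ?_⟩
      rw [Limits.zero_comp] at hy ⊢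
      obtain ⟨x', hx'⟩ := P.exact₀.desc' x hx
      have e1 : x' ≫ φ = 0 := by
        rw [← cancel_epi (P.π.f 0)]
        have : P.π.f 0 ≫ x' = x := hx'
        rw [← Category.assoc, this, hy, Limits.comp_zero]
      have e2 : ∀ z : X ⟶ Y, z ≫ φ = 0 → z = 0 := by
        intro z hz
        have := h (Ext.mk₀ z) (by rw [Ext.mk₀_comp_mk₀, hz, Ext.mk₀_zero])
        simpa using this
      have e3 : x' = 0 := e2 x' e1
      rw [← hx', e3, Limits.comp_zero]
    · have hp : (ComplexShape.up ℕ).prev (n+1) = n := by simp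
      have key : ∀ k, k + 1 = n + 1 → ∀ y : P.complex.X k ⟶ Y', 
          x ≫ φ = P.complex.d (n+1) k ≫ y → 
          ∃ w : P.complex.X k ⟶ Y, P.complex.d (n+1) k ≫ w = x := by
        intro k hk y hy
        rw [← P.extMk_eq_zero_iff x _ rfl hx k hk]
        apply h
        rw [P.extMk_comp_mk₀, P.extMk_eq_zero_iff _ _ rfl _ k hk]
        exact ⟨y, hy.symm⟩
      exact key _ (by rw [hp]) y hy
  have nat := HomologicalComplex.homologyOp_hom_naturality (linearYonedaObjMap P.complex φ) n
  have hepi : Epi (HomologicalComplex.homologyMap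
    ((HomologicalComplex.opFunctor _ _).map (linearYonedaObjMap P.complex φ).op) n) :=
    epi_of_iso_square _ _ _ _ nat (op_epi_of_mono _)
  have e := P.leftDerived_app_eq (((linearYoneda R _).map φ).rightOp) n
  have : Epi ((NatTrans.leftDerived (((linearYoneda R (ModuleCat.{u} R)).map φ).rightOp) n).app X) := by
    rw [e]
    have : Epi ((HomologicalComplex.homologyFunctor _ (ComplexShape.down ℕ) n).map
      ((NatTrans.mapHomologicalComplex (((linearYoneda R (ModuleCat.{u} R)).map φ).rightOp) _).app P.complex)) := hepi
    infer_instance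
  exact @unop_mono_of_epi _ _ _ _ _ this

/-- Filtered colimits of monos. -/
lemma localCohomology_map_injective (I : Ideal R) (Y Y' : ModuleCat.{u} R) (φ : Y ⟶ Y') (n : ℕ)
    (h : ∀ t : ℕ, Mono (((_root_.Ext R (ModuleCat.{u} R) n).obj
      (Opposite.op (ModuleCat.of R (R ⧸ I ^ t)))).map φ)) :
    Function.Injective ((localCohomology I n).map φ) := by
  let F : ℕᵒᵖᵒᵖ ⥤ ModuleCat.{u} R ⥤ ModuleCat.{u} R :=
    localCohomology.diagram (localCohomology.idealPowersDiagram I) n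
  let c := Limits.colimit.cocone F
  have hc : Limits.IsColimit c := Limits.colimit.isColimit F
  have hY := Limits.isColimitOfPreserves ((evaluation _ _).obj Y) hc
  have hY' := Limits.isColimitOfPreserves ((evaluation _ _).obj Y') hc
  change Function.Injective (c.pt.map φ)
  rw [injective_iff_map_eq_zero]
  intro z hz
  have : Limits.PreservesFilteredColimits (forget (ModuleCat.{u} R)) := inferInstance
  have : Limits.PreservesFilteredColimitsOfSize.{0, 0} (forget (ModuleCat.{u} R)) :=
    Limits.preservesFilteredColimitsOfSize_shrink.{0, u, 0, u} _
  have : IsFiltered ℕᵒᵖᵒᵖ := inferInstance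
  have : Limits.PreservesColimitsOfShape ℕᵒᵖᵒᵖ (forget (ModuleCat.{u} R)) := inferInstance
  obtain ⟨j, y, rfl⟩ := Limits.Concrete.isColimit_exists_rep _ hY z
  have hz2 : (((evaluation _ _).obj Y').mapCocone c).ι.app j ((F.obj j).map φ y) = 
     (((evaluation _ _).obj Y').mapCocone c).ι.app j 0 := by
    rw [map_zero, ← hz]
    exact (ConcreteCategory.congr_hom ((c.ι.app j).naturality φ) y)
  obtain ⟨k, a, b, hk⟩ := Limits.Concrete.isColimit_exists_of_rep_eq _ hY' _ _ hz2
  rw [map_zero] at hk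
  have hm : Mono ((F.obj k).map φ) := h _
  have e : (F.obj k).map φ ((F.map a).app Y y) = 0 := by
    rw [← hk]
    exact (ConcreteCategory.congr_hom ((F.map a).naturality φ) y).symm
  have e2 : (F.map a).app Y y = 0 := by
    apply (ModuleCat.mono_iff_injective _).1 hm
    rw [e, map_zero]
  have e3 := ConcreteCategory.congr_hom ((((evaluation _ _).obj Y).mapCocone c).w a) y
  rw [← e3]
  change (((evaluation _ _).obj Y).mapCocone c).ι.app k ((F.map a).app Y y) = 0
  rw [e2, map_zero]

lemma localCohomology_map_injective_of_regular (I : Ideal R) (rs : List R)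
    (hI : Ideal.ofList rs ≤ I) (Y Y' : ModuleCat.{u} R) (φ : Y ⟶ Y')
    (hM : IsWeaklyRegular Y rs) (hM' : IsWeaklyRegular Y' rs)
    (hφ : ∀ y : Y, φ.hom y ∈ (Ideal.ofList rs • ⊤ : Submodule R Y') →
      y ∈ (Ideal.ofList rs • ⊤ : Submodule R Y)) :
    Function.Injective ((localCohomology I rs.length).map φ) := by
  apply localCohomology_map_injective
  intro t
  apply oldExt_map_mono
  refine (ext_powers_of_regular rs Y Y' φ hM hM' hφ t _ ?_).2
  intro r hr n
  obtain ⟨n, rfl⟩ := Ideal.Quotient.mk_surjective n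
  change r • (Ideal.Quotient.mk (I ^ t)) n = 0
  rw [← Ideal.Quotient.mk_eq_mk, ← Submodule.Quotient.mk_smul, Submodule.Quotient.mk_eq_zero]
  exact Ideal.mul_mem_right _ _ (Ideal.pow_right_mono hI t hr)

end ExtPart2

section SopPart
open CategoryTheory CategoryTheory.Abelian RingTheory.Sequence Pointwise

variable {R : Type u} [CommRing R] [IsLocalRing R] [IsNoetherianRing R]

set_option linter.unusedSectionVars false

def ExtVan (M : ModuleCat.{u} R) (n : ℕ) : Prop :=
  ∀ i < n, ∀ ξ : Abelian.Ext.{u} (ModuleCat.of R (R ⧸ maximalIdeal R)) M i, ξ = 0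

lemma ExtVan.quot {M : ModuleCat.{u} R} {n : ℕ} (h : ExtVan M (n + 1)) {y : R}
    (hy : IsSMulRegular M y) : ExtVan (ModuleCat.of R (QuotSMulTop y M)) n := by
  intro i hi ξ
  have hS := hy.smulShortComplex_shortExact
  obtain ⟨η, hη⟩ := Ext.covariant_sequence_exact₃ (ModuleCat.of R (R ⧸ maximalIdeal R)) hS ξ rfl
    (h (i + 1) (by omega) _)
  have : η = 0 := h i (by omega) η
  rw [← hη, this]
  exact Ext.zero_comp ..

lemma ExtVan.exists_regular {M : ModuleCat.{u} R} [Module.Finite R M] {n : ℕ}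
    (h : ExtVan M (n + 1)) : ∃ y ∈ maximalIdeal R, IsSMulRegular M y := by
  have : Subsingleton ((R ⧸ maximalIdeal R) →ₗ[R] M) := by
    refine subsingleton_of_forall_eq 0 fun f => ?_
    have := h 0 (by omega) (Ext.mk₀ (ModuleCat.ofHom f))
    have h2 : ModuleCat.ofHom f = 0 := by simpa using this
    simpa using congrArg ModuleCat.Hom.hom h2
  obtain ⟨r, hr, h2⟩ := IsSMulRegular.subsingleton_linearMap_iff.1 this
  rw [Ideal.annihilator_quotient] at hr
  exact ⟨r, hr, h2⟩

lemma exists_assoc_quot (M : ModuleCat.{u} R) [Module.Finite R M] {P : Ideal R}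
    (hP : P ∈ associatedPrimes R M) {y : R} (hy : y ∈ maximalIdeal R) (hreg : IsSMulRegular M y) :
    ∃ P' ∈ associatedPrimes R (QuotSMulTop y M), P ≤ P' ∧ y ∈ P' := by
  rw [AssociatedPrimes.mem_iff, isAssociatedPrime_iff] at hP
  obtain ⟨hPp, x, hx⟩ := hP
  -- N = elements killed by P
  let N : Submodule R M :=
    { carrier := {m | ∀ p ∈ P, p • m = 0}
      add_mem' := fun {a b} ha hb p hp => by rw [smul_add, ha p hp, hb p hp, add_zero]
      zero_mem' := fun p _ => smul_zero p
      smul_mem' := fun c a ha p hp => by rw [smul_comm, ha p hp, smul_zero] }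
  have hxN : x ∈ N := by
    intro p hp
    rw [hx] at hp
    rwa [Submodule.mem_colon_singleton, Submodule.mem_bot] at hp
  have hx0 : x ≠ 0 := by
    rintro rfl
    apply hPp.ne_top
    rw [hx]; ext; simp [Submodule.mem_colon_singleton]
  have hNot : ¬ N ≤ y • (⊤ : Submodule R M) := by
    intro hle
    have hN : N ≤ Ideal.span {y} • N := by
      intro m hm
      obtain ⟨m', -, hm'⟩ := (Submodule.mem_smul_pointwise_iff_exists _ _ _).1 (hle hm)
      have : m' ∈ N := by
        intro p hp
        apply hreg
        change y • (p • m') = y • 0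
        rw [smul_comm, hm', smul_zero]
        exact hm p hp
      rw [← hm']
      exact Submodule.smul_mem_smul (Ideal.mem_span_singleton_self y) this
    have hbot : N = ⊥ := by
      refine Submodule.eq_bot_of_le_smul_of_le_jacobson_bot (Ideal.span {y}) N
        (IsNoetherian.noetherian N) hN ?_
      rw [IsLocalRing.jacobson_eq_maximalIdeal ⊥ bot_ne_top, Ideal.span_singleton_le_iff_mem]
      exact hy
    rw [hbot] at hxN
    exact hx0 hxN
  obtain ⟨m, hmN, hm⟩ := Set.not_subset.1 hNot
  have hm0 : (Submodule.Quotient.mk m : QuotSMulTop y M) ≠ 0 := by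
    rwa [Ne, Submodule.Quotient.mk_eq_zero]
  obtain ⟨P', hP', hle⟩ := exists_le_isAssociatedPrime_of_isNoetherianRing R _ hm0
  refine ⟨P', hP', fun p hp => hle ?_, hle ?_⟩
  · rw [Submodule.mem_colon_singleton, ← Submodule.Quotient.mk_smul, hmN p hp]; simp
  · rw [Submodule.mem_colon_singleton, ← Submodule.Quotient.mk_smul, Submodule.mem_bot,
      Submodule.Quotient.mk_eq_zero]
    exact Submodule.smul_mem_pointwise_smul _ _ _ trivial

lemma ExtVan.le_dim (n : ℕ) : ∀ (M : ModuleCat.{u} R) [Module.Finite R M], ExtVan M n →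
    ∀ P ∈ associatedPrimes R M, (n : WithBot ℕ∞) ≤ ringKrullDim (R ⧸ P) := by
  induction n with
  | zero =>
    intro M _ h P hP
    have : Nontrivial (R ⧸ P) := Ideal.Quotient.nontrivial_iff.2 hP.1.ne_top
    exact ringKrullDim_nonneg_of_nontrivial
  | succ n ih =>
    intro M _ h P hP
    obtain ⟨y, hy, hreg⟩ := h.exists_regular
    obtain ⟨P', hP', hle, hyP'⟩ := exists_assoc_quot M hP hy hreg
    have h1 := ih (ModuleCat.of R (QuotSMulTop y M)) (h.quot hreg) P' hP'
    have hPp : P.IsPrime := hP.1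
    have hyP : y ∉ P := by
      intro hyP
      have : y ∈ ⋃ p ∈ associatedPrimes R M, (p : Set R) := by
        simp only [Set.mem_iUnion]; exact ⟨P, hP, hyP⟩
      rw [biUnion_associatedPrimes_eq_compl_regular] at this
      exact this hreg
    have h2 := ringKrullDim_succ_le_of_surjective (Ideal.Quotient.factor hle)
      (Ideal.Quotient.factor_surjective hle) (r := Ideal.Quotient.mk P y)
      (mem_nonZeroDivisors_of_ne_zero (by rwa [Ne, Ideal.Quotient.eq_zero_iff_mem]))
      (by rw [Ideal.Quotient.factor_mk, Ideal.Quotient.eq_zero_iff_mem]; exact hyP')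
    push_cast
    exact (add_le_add_left h1 1).trans h2

lemma dim_le_of_radical (P : Ideal R) [P.IsPrime] (xs : List R)
    (h : maximalIdeal R ≤ (P ⊔ Ideal.ofList xs).radical) (hxs : ∀ x ∈ xs, x ∈ maximalIdeal R) :
    ringKrullDim (R ⧸ P) ≤ (xs.length : WithBot ℕ∞) := by
  have : Nontrivial (R ⧸ P) := Ideal.Quotient.nontrivial_iff.2 (Ideal.IsPrime.ne_top')
  have : IsLocalRing (R ⧸ P) := .of_surjective' (Ideal.Quotient.mk P) Ideal.Quotient.mk_surjective
  rw [ringKrullDim_le_iff_isMaximal_height_le]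
  intro m hm
  obtain rfl := IsLocalRing.eq_maximalIdeal hm
  classical
  let s : Set (R ⧸ P) := ((xs.map (Ideal.Quotient.mk P)).toFinset : Set (R ⧸ P))
  have hcomap : (maximalIdeal (R ⧸ P)).comap (Ideal.Quotient.mk P) = maximalIdeal R := by
    have := Ideal.comap_isMaximal_of_surjective (Ideal.Quotient.mk P)
      Ideal.Quotient.mk_surjective (K := maximalIdeal (R ⧸ P))
    exact IsLocalRing.eq_maximalIdeal this
  have hs : s ⊆ maximalIdeal (R ⧸ P) := by
    intro z hz
    simp only [s, List.coe_toFinset, List.mem_map, Set.mem_ofPred_eq] at hz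
    obtain ⟨a, ha, rfl⟩ := hz
    change a ∈ (maximalIdeal (R ⧸ P)).comap (Ideal.Quotient.mk P)
    rw [hcomap]; exact hxs a ha
  have hmin : maximalIdeal (R ⧸ P) ∈ (Ideal.span s).minimalPrimes := by
    refine ⟨⟨hm.isPrime, Ideal.span_le.2 hs⟩, ?_⟩
    rintro J ⟨hJ, hJs⟩ hJm
    intro z hz
    obtain ⟨z, rfl⟩ := Ideal.Quotient.mk_surjective z
    have hzm : z ∈ maximalIdeal R := by rw [← hcomap]; exact hz
    have hJ' := hJ.comap (Ideal.Quotient.mk P)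
    have : (P ⊔ Ideal.ofList xs).radical ≤ J.comap (Ideal.Quotient.mk P) := by
      rw [hJ'.radical_le_iff]
      refine sup_le (fun p hp => ?_) (Ideal.span_le.2 fun a ha => ?_)
      · rw [Ideal.mem_comap, Ideal.Quotient.eq_zero_iff_mem.2 hp]; exact zero_mem _
      · apply hJs
        apply Ideal.subset_span
        simp only [s, List.coe_toFinset, List.mem_map, Set.mem_ofPred_eq]
        exact ⟨a, ha, rfl⟩
    exact this (h hzm)
  have h1 := Ideal.height_le_spanRank_toENat_of_mem_minimalPrimes _ _ hmin
  have h2 : (Submodule.spanRank (Ideal.span s)).toENat ≤ (xs.length : ℕ∞) := by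
    have := Submodule.spanRank_span_le_card (R := R ⧸ P) (s := s)
    refine (Cardinal.toENat.monotone' this).trans ?_
    have h3 : s.encard ≤ (xs.length : ℕ∞) := by
      rw [Set.encard_coe_eq_coe_finsetCard]
      exact_mod_cast (List.toFinset_card_le _).trans (by simp)
    exact h3
  exact_mod_cast h1.trans h2

lemma weaklyRegular_of_extVan (xs : List R) : ∀ (M : ModuleCat.{u} R) [Module.Finite R M],
    ExtVan M xs.length → (∀ x ∈ xs, x ∈ maximalIdeal R) →
    maximalIdeal R ≤ (Module.annihilator R M ⊔ Ideal.ofList xs).radical →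
    IsWeaklyRegular M xs := by
  induction xs with
  | nil => intro M _ _ _ _; exact IsWeaklyRegular.nil R M
  | cons a xs ih =>
    intro M _ hM hxs hrad
    have ha : IsSMulRegular M a := by
      by_contra hna
      have : a ∈ ⋃ p ∈ associatedPrimes R M, (p : Set R) := by
        rw [biUnion_associatedPrimes_eq_compl_regular]; exact hna
      simp only [Set.mem_iUnion] at this
      obtain ⟨P, hP, haP⟩ := this
      have hPp : P.IsPrime := hP.1
      have h1 := hM.le_dim _ M P hP
      have h2 := dim_le_of_radical P xs (hrad.trans (Ideal.radical_mono ?_))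
        (fun x hx => hxs x (by simp [hx]))
      · have h3 := h1.trans h2
        simp only [List.length_cons] at h3
        have h4 : xs.length + 1 ≤ xs.length := by exact_mod_cast h3
        omega
      · have hann : Module.annihilator R M ≤ P := by
          have := IsAssociatedPrime.annihilator_le hP
          rwa [Submodule.annihilator_top] at this
        refine sup_le (hann.trans le_sup_left) ?_
        rw [Ideal.ofList_cons]
        refine sup_le ?_ le_sup_right
        rw [Ideal.span_singleton_le_iff_mem]
        exact Ideal.mem_sup_left haP
    rw [isWeaklyRegular_cons_iff]
    refine ⟨ha, ih (ModuleCat.of R (QuotSMulTop a M)) (hM.quot ha)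
      (fun x hx => hxs x (by simp [hx])) (hrad.trans (Ideal.radical_mono ?_))⟩
    rw [Ideal.ofList_cons, ← sup_assoc]
    refine sup_le_sup_right (sup_le ?_ ?_) _
    · exact LinearMap.annihilator_le_of_surjective _ (Submodule.mkQ_surjective _)
    · rw [Ideal.span_singleton_le_iff_mem, Module.mem_annihilator]
      intro m
      obtain ⟨m, rfl⟩ := Submodule.Quotient.mk_surjective _ m
      rw [← Submodule.Quotient.mk_smul, Submodule.Quotient.mk_eq_zero]
      exact Submodule.smul_mem_pointwise_smul _ _ _ trivial

lemma weaklyRegular_of_depth (ys xs : List R) (hlen : ys.length = xs.length)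
    (hys : ∀ y ∈ ys, y ∈ maximalIdeal R) (hreg : IsWeaklyRegular R ys)
    (hxs : ∀ x ∈ xs, x ∈ maximalIdeal R) (hrad : maximalIdeal R ≤ (Ideal.ofList xs).radical) :
    IsWeaklyRegular R xs := by
  refine weaklyRegular_of_extVan xs (ModuleCat.of R R) ?_ hxs
    (hrad.trans (Ideal.radical_mono le_sup_right))
  intro i hi ξ
  refine ext_subsingleton_of_regular ys _ _ ?_ hreg i (hlen ▸ hi) ξ
  intro r hr n
  obtain ⟨n, rfl⟩ := Ideal.Quotient.mk_surjective n
  change r • (Ideal.Quotient.mk (maximalIdeal R)) n = 0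
  rw [← Ideal.Quotient.mk_eq_mk, ← Submodule.Quotient.mk_smul, Submodule.Quotient.mk_eq_zero]
  exact Ideal.mul_mem_right _ _ (hys r hr)

end SopPart

section QuasiRegular
open MvPolynomial

lemma prod_pow_mem_span_pow {A ι : Type*} [CommRing A] (x : ι → A) (s : ι →₀ ℕ) :
    (s.prod fun i k => x i ^ k) ∈ (Ideal.span (Set.range x)) ^ s.degree := by
  rw [Finsupp.prod, Finsupp.degree_apply, ← Finset.prod_pow_eq_pow_sum]
  apply Ideal.prod_mem_prod
  intro i _
  exact Ideal.pow_mem_pow (Ideal.subset_span (Set.mem_range_self i)) _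

lemma mem_pow_smul_iff {A D ι : Type*} [CommRing A] [CommRing D] [Algebra A D]
    (x : ι → A) (W : Submodule A D) (n : ℕ) (b : D) :
    b ∈ (Ideal.span (Set.range x)) ^ n • W ↔ ∃ F : MvPolynomial ι D, F.IsHomogeneous n ∧
      (∀ s, F.coeff s ∈ W) ∧ eval (fun i => algebraMap A D (x i)) F = b := by
  constructor
  · intro hb
    refine Submodule.smul_induction_on hb ?_ ?_
    · intro r hr w hw
      obtain ⟨p, hp, rfl⟩ := (Ideal.mem_span_pow_iff_exists_isHomogeneous x r).1 hr
      refine ⟨C w * map (algebraMap A D) p, ?_, ?_, ?_⟩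
      · simpa using (isHomogeneous_C _ w).mul (hp.map (algebraMap A D))
      · intro s
        rw [coeff_C_mul, coeff_map, mul_comm, ← Algebra.smul_def]
        exact W.smul_mem _ hw
      · rw [map_mul, eval_C, Algebra.smul_def, eval_map, eval₂_eq, eval_eq, map_sum, mul_comm]
        simp
    · rintro _ _ ⟨F, h1, h2, rfl⟩ ⟨G, h3, h4, rfl⟩
      exact ⟨F + G, h1.add h3, fun s => by rw [coeff_add]; exact W.add_mem (h2 s) (h4 s), by simp⟩
  · rintro ⟨F, h1, h2, rfl⟩
    rw [eval_eq]
    refine Submodule.sum_mem _ fun s hs => ?_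
    have : (∏ i ∈ s.support, algebraMap A D (x i) ^ s i) =
      algebraMap A D (s.prod fun i k => x i ^ k) := by
      simp [Finsupp.prod]
    rw [this, mul_comm, ← Algebra.smul_def]
    refine Submodule.smul_mem_smul ?_ (h2 s)
    have hdeg := h1 (mem_support_iff.1 hs)
    have h := prod_pow_mem_span_pow x s
    rwa [show s.degree = n by rw [← hdeg, Finsupp.degree_eq_weight_one]; rfl] at h

lemma homogeneous_split {A : Type*} [CommRing A] {d n : ℕ} (F : MvPolynomial (Fin (d + 1)) A)
    (hF : F.IsHomogeneous (n + 1)) : ∃ (G : MvPolynomial (Fin d) A)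
      (H : MvPolynomial (Fin (d + 1)) A), G.IsHomogeneous (n + 1) ∧ H.IsHomogeneous n ∧
      F = rename Fin.succ G + X 0 * H := by
  rw [F.as_sum]
  have hmem : ∀ s ∈ F.support, s.degree = n + 1 := by
    intro s hs
    have := hF (mem_support_iff.1 hs)
    rw [Finsupp.degree_eq_weight_one]; exact this
  revert hmem
  generalize F.support = S
  intro hmem
  induction S using Finset.induction_on with
  | empty => exact ⟨0, 0, isHomogeneous_zero _ _ _, isHomogeneous_zero _ _ _, by simp⟩
  | insert s S hs ih =>
    obtain ⟨G, H, hG, hH, e⟩ := ih fun t ht => hmem t (Finset.mem_insert_of_mem ht)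
    rw [Finset.sum_insert hs, e]
    have hsd := hmem s (Finset.mem_insert_self _ _)
    by_cases h0 : s 0 = 0
    · refine ⟨monomial s.tail (coeff s F) + G, H, (isHomogeneous_monomial _ ?_).add hG, hH, ?_⟩
      · rw [← hsd, Finsupp.degree_eq_sum, Finsupp.degree_eq_sum, Fin.sum_univ_succ, h0]
        simp [Finsupp.tail_apply]
      · rw [map_add, rename_monomial, add_assoc]
        have he : Finsupp.mapDomain Fin.succ s.tail = s := by
          refine Finsupp.ext fun i => ?_
          refine Fin.cases ?_ (fun j => ?_) i
          · rw [h0, Finsupp.mapDomain_of_notMem_range]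
            simp
          · rw [Finsupp.mapDomain_apply (Fin.succ_injective _), Finsupp.tail_apply]
        rw [he]
    · have hle : Finsupp.single 0 1 ≤ s := by
        rw [Finsupp.single_le_iff]; omega
      refine ⟨G, monomial (s - Finsupp.single 0 1) (coeff s F) + H, hG,
        (isHomogeneous_monomial _ ?_).add hH, ?_⟩
      · have := congrArg Finsupp.degree (tsub_add_cancel_of_le hle)
        rw [map_add, hsd, Finsupp.degree_single] at this
        omega
      · rw [mul_add, X, monomial_mul, one_mul, add_tsub_cancel_of_le hle]
        ring

/-- `x i` is a nonzerodivisor modulo the later ones. -/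
def RegRev {A : Type*} [CommRing A] {d : ℕ} (x : Fin d → A) : Prop :=
  ∀ i : Fin d, ∀ a : A, x i * a ∈ Ideal.span (x '' {j | i < j}) →
    a ∈ Ideal.span (x '' {j | i < j})

def QuasiReg {A : Type*} [CommRing A] {d : ℕ} (x : Fin d → A) : Prop :=
  ∀ (n : ℕ) (F : MvPolynomial (Fin d) A), F.IsHomogeneous n →
    eval x F ∈ (Ideal.span (Set.range x)) ^ (n + 1) →
    F ∈ (Ideal.span (Set.range x)).map (C : A →+* MvPolynomial (Fin d) A)

lemma exists_homog_mem_map {A ι : Type*} [CommRing A] (x : ι → A) (n : ℕ) (a : A)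
    (ha : a ∈ (Ideal.span (Set.range x)) ^ (n + 1)) :
    ∃ F : MvPolynomial ι A, F.IsHomogeneous n ∧
      F ∈ (Ideal.span (Set.range x)).map (C : A →+* MvPolynomial ι A) ∧ eval x F = a := by
  rw [pow_succ, ← smul_eq_mul, mem_pow_smul_iff] at ha
  obtain ⟨F, h1, h2, h3⟩ := ha
  exact ⟨F, h1, mem_map_C_iff.2 h2, h3⟩

lemma quasiReg_of_regRev (d : ℕ) {A : Type*} [CommRing A] : ∀ (x : Fin d → A), RegRev x → QuasiReg x := by
  induction d with
  | zero =>
    intro x _ n F hF h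
    have : IsEmpty (Fin 0) := inferInstance
    obtain ⟨a, rfl⟩ := C_surjective (R := A) (Fin 0) F
    have hr : Ideal.span (Set.range x) = ⊥ := by simp
    rw [hr] at h ⊢
    rw [eval_C] at h
    have : a = 0 := by simpa [Ideal.bot_pow] using Ideal.pow_le_self (Nat.succ_ne_zero n) h
    simp [this]
  | succ d ih =>
    intro x hx
    let x' : Fin d → A := fun i => x i.succ
    let y := x 0
    have hx' : RegRev x' := by
      intro i a h
      have e : x' '' {j | i < j} = x '' {j | i.succ < j} := by
        ext z; constructor
        · rintro ⟨j, hj, rfl⟩; exact ⟨j.succ, by simpa using hj, rfl⟩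
        · rintro ⟨j, hj, rfl⟩
          obtain ⟨j, rfl⟩ := Fin.exists_succ_eq.2 (show j ≠ 0 from (lt_of_le_of_lt (Fin.zero_le _) hj).ne')
          exact ⟨j, by simpa using hj, rfl⟩
      rw [e] at h ⊢
      exact hx _ _ h
    have QI := ih x' hx'
    set I := Ideal.span (Set.range x') with hI
    set Q := Ideal.span (Set.range x) with hQ
    have hIQ : I ≤ Q := Ideal.span_mono (by rintro _ ⟨i, rfl⟩; exact ⟨i.succ, rfl⟩)
    have hyQ : y ∈ Q := Ideal.subset_span ⟨0, rfl⟩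
    have hy : ∀ a, y * a ∈ I → a ∈ I := by
      have e : Set.range x' = x '' {j | 0 < j} := by
        ext z; constructor
        · rintro ⟨j, rfl⟩; exact ⟨j.succ, by simp, rfl⟩
        · rintro ⟨j, hj, rfl⟩
          obtain ⟨j, rfl⟩ := Fin.exists_succ_eq.2 (show j ≠ 0 from hj.ne')
          exact ⟨j, rfl⟩
      rw [hI, e]; exact hx 0
    have hyn : ∀ n a, y * a ∈ I ^ n → a ∈ I ^ n := by
      intro n
      induction n with
      | zero => intro a _; simp
      | succ n ihn =>
        intro a ha
        have h1 := ihn a (Ideal.pow_le_pow_right (Nat.le_succ n) ha)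
        obtain ⟨F, hF, rfl⟩ := (Ideal.mem_span_pow_iff_exists_isHomogeneous x' a).1 h1
        have h2 := QI n (C y * F) (by simpa using (isHomogeneous_C _ y).mul hF) (by simpa using ha)
        rw [pow_succ, ← smul_eq_mul, mem_pow_smul_iff]
        refine ⟨F, hF, fun s => hy _ ?_, rfl⟩
        have := mem_map_C_iff.1 h2 s
        rwa [coeff_C_mul] at this
    intro n
    induction n with
    | zero =>
      intro F hF h
      obtain ⟨a, rfl⟩ : ∃ a, F = C a := ⟨_, totalDegree_eq_zero_iff_eq_C.1
        (Nat.le_zero.1 hF.totalDegree_le)⟩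
      rw [eval_C] at h
      exact Ideal.mem_map_of_mem _ (by simpa using h)
    | succ n ihn =>
      intro F hF h
      -- reduce to eval = 0
      suffices key : ∀ F : MvPolynomial (Fin (d + 1)) A, F.IsHomogeneous (n + 1) → eval x F = 0 →
          F ∈ Q.map C by
        obtain ⟨F', h1, h2, h3⟩ := exists_homog_mem_map x _ _ h
        have := key (F - F') (hF.sub h1) (by rw [map_sub, h3, sub_self])
        simpa using add_mem this h2
      intro F hF h
      obtain ⟨G, H, hG, hH, rfl⟩ := homogeneous_split F hF
      rw [map_add, map_mul, eval_X, eval_rename] at h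
      have hGI : eval x' G ∈ I ^ (n + 1) :=
        (Ideal.mem_span_pow_iff_exists_isHomogeneous x' _).2 ⟨G, hG, rfl⟩
      have h1 : eval x H ∈ I ^ (n + 1) := by
        apply hyn
        have : y * eval x H = - eval x' G := by
          rw [eq_neg_iff_add_eq_zero, add_comm]; exact h
        rw [this]
        exact neg_mem hGI
      have h2 : H ∈ Q.map C := ihn H hH (Ideal.pow_right_mono hIQ _ h1)
      obtain ⟨K, hK, hKe⟩ := (Ideal.mem_span_pow_iff_exists_isHomogeneous x' _).1 h1
      have h3 : G + C y * K ∈ I.map C := by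
        apply QI (n + 1) _ (hG.add (by simpa using (isHomogeneous_C _ y).mul hK))
        have : eval x' (G + C y * K) = 0 := by
          rw [map_add, map_mul, eval_C, hKe]; exact h
        rw [this]; exact zero_mem _
      have h4 : G ∈ Q.map C := by
        have e1 : C y * K ∈ Q.map (C : A →+* MvPolynomial (Fin d) A) :=
          Ideal.mul_mem_right _ _ (Ideal.mem_map_of_mem _ hyQ)
        have := sub_mem (Ideal.map_mono hIQ h3) e1
        simpa using this
      refine add_mem ?_ (Ideal.mul_mem_left _ _ h2)
      have := Ideal.mem_map_of_mem (rename (R := A) (Fin.succ : Fin d → Fin (d + 1))).toRingHom h4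
      rw [Ideal.map_map] at this
      have e : ((rename (R := A) (Fin.succ : Fin d → Fin (d + 1))).toRingHom : MvPolynomial (Fin d) A →+* MvPolynomial (Fin (d+1)) A).comp C = C := by
        ext a
        simp
      rw [e] at this
      exact this

lemma regRev_of_isWeaklyRegular {A : Type*} [CommRing A] {d : ℕ} (x : Fin d → A)
    (h : RingTheory.Sequence.IsWeaklyRegular A (List.ofFn fun i => x i.rev)) : RegRev x := by
  intro i a ha
  have hi : i.rev.1 < (List.ofFn fun i => x i.rev).length := by
    rw [List.length_ofFn]; exact i.rev.2
  have h1 := h.regular_mod_prev i.rev.1 hi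
  have e : Ideal.ofList (List.take i.rev.1 (List.ofFn fun i => x i.rev)) =
      Ideal.span (x '' {j | i < j}) := by
    rw [Ideal.ofList]
    congr 1
    ext z
    simp only [Set.mem_ofPred_eq, Set.mem_image, List.mem_take_iff_getElem, List.getElem_ofFn,
      List.length_ofFn]
    constructor
    · rintro ⟨k, hk, rfl⟩
      refine ⟨_, ?_, rfl⟩
      rw [Fin.lt_def]
      simp only [Fin.val_rev] at hk ⊢
      omega
    · rintro ⟨j, hj, rfl⟩
      refine ⟨j.rev.1, ?_, by rw [Fin.eta, Fin.rev_rev]⟩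
      rw [Fin.lt_def] at hj
      simp only [Fin.val_rev] at hj ⊢
      omega
  rw [e] at h1
  have e2 : (List.ofFn fun i => x i.rev)[i.rev.1] = x i := by rw [List.getElem_ofFn, Fin.eta, Fin.rev_rev]
  rw [e2, smul_eq_mul, Ideal.mul_top, isSMulRegular_iff_right_eq_zero_of_smul] at h1
  have h2 := h1 (Submodule.Quotient.mk a) (by
    rw [← Submodule.Quotient.mk_smul, Submodule.Quotient.mk_eq_zero]; exact ha)
  rwa [Submodule.Quotient.mk_eq_zero] at h2

end QuasiRegular

section Lengths

variable {R : Type u} [CommRing R]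

lemma length_quot_eq_add {K L : Ideal R} (h : K ≤ L) :
    Module.length R (R ⧸ K) = Module.length R (LinearMap.ker (Submodule.factor h)) +
      Module.length R (R ⧸ L) :=
  Module.length_eq_add_of_exact (LinearMap.ker (Submodule.factor h)).subtype (Submodule.factor h)
    (Submodule.subtype_injective _) (Submodule.factor_surjective h)
    (LinearMap.exact_subtype_ker_map _)

lemma length_quot_anti {K L : Ideal R} (h : K ≤ L) :
    Module.length R (R ⧸ L) ≤ Module.length R (R ⧸ K) := by
  rw [length_quot_eq_add h]; exact le_add_self

lemma length_lower {K L I : Ideal R} (h : K ≤ L) {ι : Type*} [Fintype ι] (l : ι → R)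
    (hl : ∀ i, l i ∈ L) (H : ∀ c : ι → R, ∑ i, c i * l i ∈ K → ∀ i, c i ∈ I) :
    Module.length R (R ⧸ L) + Fintype.card ι * Module.length R (R ⧸ I) ≤
      Module.length R (R ⧸ K) := by
  rw [length_quot_eq_add h, add_comm]
  gcongr
  let f : (ι → R) →ₗ[R] LinearMap.ker (Submodule.factor h) :=
    LinearMap.codRestrict _ (K.mkQ ∘ₗ (Fintype.linearCombination R l)) (by
      intro c
      rw [LinearMap.mem_ker, LinearMap.comp_apply, Submodule.factor_mk, Submodule.mkQ_apply,
        Submodule.Quotient.mk_eq_zero, Fintype.linearCombination_apply]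
      exact Submodule.sum_mem _ fun i _ => Ideal.mul_mem_left _ _ (hl i))
  have hf : LinearMap.ker f ≤ LinearMap.ker (LinearMap.pi fun i => I.mkQ ∘ₗ LinearMap.proj i :
      (ι → R) →ₗ[R] (ι → R ⧸ I)) := by
    intro c hc
    have h1 : K.mkQ (Fintype.linearCombination R l c) = 0 := congrArg Subtype.val hc
    rw [Submodule.mkQ_apply, Submodule.Quotient.mk_eq_zero,
      Fintype.linearCombination_apply] at h1
    rw [LinearMap.mem_ker]
    funext i
    exact (Submodule.Quotient.mk_eq_zero _).2 (H c h1 i)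
  have h1 : Module.length R ((ι → R) ⧸ LinearMap.ker f) ≤
      Module.length R (LinearMap.ker (Submodule.factor h)) :=
    Module.length_le_of_injective ((LinearMap.ker f).liftQ f le_rfl)
      (LinearMap.ker_eq_bot.1 (Submodule.ker_liftQ_eq_bot _ _ _ le_rfl))
  have h2 : Module.length R (ι → R ⧸ I) ≤ Module.length R ((ι → R) ⧸ LinearMap.ker f) := by
    refine Module.length_le_of_surjective ((LinearMap.ker f).liftQ _ hf) ?_
    intro c
    choose b hb using fun i => Submodule.mkQ_surjective I (c i)
    exact ⟨Submodule.Quotient.mk b, by rw [Submodule.liftQ_apply]; funext i; exact hb i⟩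
  rw [Module.length_pi, ENat.card_eq_coe_fintype_card] at h2
  exact h2.trans h1

lemma length_upper {K L I : Ideal R} (h : K ≤ L) {ι : Type*} [Fintype ι] (l : ι → R)
    (hl : L ≤ K ⊔ Ideal.span (Set.range l)) (H : ∀ i, ∀ c ∈ I, c * l i ∈ K) :
    Module.length R (R ⧸ K) ≤
      Module.length R (R ⧸ L) + Fintype.card ι * Module.length R (R ⧸ I) := by
  rw [length_quot_eq_add h, add_comm]
  gcongr
  let g : ι → (R ⧸ I) →ₗ[R] (R ⧸ K) := fun i => I.liftQ (K.mkQ ∘ₗ LinearMap.toSpanSingleton R R (l i)) (by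
    intro c hc
    rw [LinearMap.mem_ker, LinearMap.comp_apply, Submodule.mkQ_apply,
        Submodule.Quotient.mk_eq_zero]
    exact H i c hc)
  let f : (ι → R ⧸ I) →ₗ[R] (R ⧸ K) := ∑ i, g i ∘ₗ LinearMap.proj i
  have hker : LinearMap.ker (Submodule.factor h) ≤ LinearMap.range f := by
    intro z hz
    obtain ⟨z, rfl⟩ := Submodule.Quotient.mk_surjective _ z
    rw [LinearMap.mem_ker, ← Submodule.mkQ_apply, Submodule.factor_mk, Submodule.mkQ_apply, Submodule.Quotient.mk_eq_zero] at hz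
    obtain ⟨k, hk, w, hw, rfl⟩ := Submodule.mem_sup.1 (hl hz)
    obtain ⟨c, rfl⟩ := (Ideal.mem_span_range_iff_exists_fun).1 hw
    refine ⟨fun i => Submodule.Quotient.mk (c i), ?_⟩
    have e1 : f (fun i => Submodule.Quotient.mk (c i)) = Submodule.Quotient.mk (∑ i, c i * l i) := by
      simp only [f, LinearMap.sum_apply, LinearMap.comp_apply, LinearMap.proj_apply]
      rw [← Submodule.mkQ_apply, map_sum]
      rfl
    rw [e1, Submodule.Quotient.eq]
    have e2 : (∑ i, c i * l i) - (k + ∑ i, c i * l i) = - k := by ring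
    rw [e2]; exact neg_mem hk
  have h1 := Module.length_le_of_injective (Submodule.inclusion hker)
    (Submodule.inclusion_injective hker)
  have h2 : Module.length R (LinearMap.range f) ≤ Module.length R (ι → R ⧸ I) :=
    Module.length_le_of_surjective f.rangeRestrict f.surjective_rangeRestrict
  rw [Module.length_pi, ENat.card_eq_coe_fintype_card] at h2
  exact h1.trans h2

/-- monomials of degree `n` in `d` variables -/
abbrev Mono (d n : ℕ) := {s : Fin d →₀ ℕ // s ∈ Finset.finsuppAntidiag (Finset.univ : Finset (Fin d)) n}

lemma mono_degree {d n : ℕ} (s : Mono d n) : s.1.degree = n := by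
  have := s.2
  rw [Finset.mem_finsuppAntidiag] at this
  rw [Finsupp.degree_eq_sum]; exact this.1

def Mono.mk' {d n : ℕ} (s : Fin d →₀ ℕ) (h : s.degree = n) : Mono d n :=
  ⟨s, by rw [Finset.mem_finsuppAntidiag, ← h, Finsupp.degree_eq_sum]; simp⟩

lemma card_mono (d n : ℕ) : Fintype.card (Mono (d + 1) n) = (n + d).choose d := by
  rw [Fintype.card_coe, Finset.card_finsuppAntidiag_nat_eq_choose]
  simp only [Finset.card_univ, Fintype.card_fin]
  rw [show d + 1 + n - 1 = n + d by omega, Nat.choose_symm_add]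

lemma sum_choose_eq (d n : ℕ) : ∑ k ∈ Finset.range (n+1), (k + d).choose d = (n + (d+1)).choose (d+1) := by
  rw [Nat.sum_range_add_choose]; rfl

end Lengths

section PowLengths
open MvPolynomial

/-- the value of the monomial `x^s` -/
def xpow {A : Type*} [CommRing A] {d : ℕ} (x : Fin d → A) (s : Fin d →₀ ℕ) : A := 
  s.prod fun i k => x i ^ k

lemma xpow_mem {A : Type*} [CommRing A] {d : ℕ} (x : Fin d → A) {n : ℕ} (s : Mono d n) :
    xpow x s.1 ∈ (Ideal.span (Set.range x)) ^ n := by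
  have := prod_pow_mem_span_pow x s.1
  rwa [mono_degree] at this

lemma weight_one_eq {d n : ℕ} {A : Type*} [CommRing A] {F : MvPolynomial (Fin d) A}
    (hF : F.IsHomogeneous n) {s : Fin d →₀ ℕ} (h : F.coeff s ≠ 0) : s.degree = n := by
  rw [Finsupp.degree_eq_weight_one]; exact hF h

/-- polynomial with prescribed coefficients in degree `n` -/
noncomputable def polyOf {A : Type*} [CommRing A] {d n : ℕ} (c : Mono d n → A) :
    MvPolynomial (Fin d) A := ∑ s, monomial s.1 (c s)

lemma polyOf_homog {A : Type*} [CommRing A] {d n : ℕ} (c : Mono d n → A) :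
    (polyOf c).IsHomogeneous n :=
  IsHomogeneous.sum _ _ _ fun s _ => isHomogeneous_monomial _ (mono_degree s)

lemma polyOf_coeff {A : Type*} [CommRing A] {d n : ℕ} (c : Mono d n → A) (s : Mono d n) :
    (polyOf c).coeff s.1 = c s := by
  classical
  rw [polyOf, coeff_sum, Finset.sum_eq_single s]
  · simp
  · intro t _ h
    rw [coeff_monomial, if_neg]
    exact fun e => h (Subtype.ext e)
  · simp

lemma polyOf_eval {A : Type*} [CommRing A] {d n : ℕ} (c : Mono d n → A) (x : Fin d → A) :
    eval x (polyOf c) = ∑ s, c s * xpow x s.1 := by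
  rw [polyOf, map_sum]
  simp only [eval_monomial, xpow]

lemma eq_polyOf {A : Type*} [CommRing A] {d n : ℕ} {F : MvPolynomial (Fin d) A}
    (hF : F.IsHomogeneous n) : F = polyOf (fun s : Mono d n => F.coeff s.1) := by
  ext s
  by_cases h : s.degree = n
  · exact (polyOf_coeff (fun s : Mono d n => F.coeff s.1) (Mono.mk' s h)).symm
  · rw [hF.coeff_eq_zero h, (polyOf_homog _).coeff_eq_zero h]

lemma span_pow_le {A : Type*} [CommRing A] {d : ℕ} (x : Fin d → A) (n : ℕ) :
    (Ideal.span (Set.range x)) ^ n ≤ Ideal.span (Set.range fun s : Mono d n => xpow x s.1) := by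
  intro a ha
  obtain ⟨F, hF, rfl⟩ := (Ideal.mem_span_pow_iff_exists_isHomogeneous x a).1 ha
  rw [eq_polyOf hF, polyOf_eval]
  exact Ideal.sum_mem _ fun s _ => Ideal.mul_mem_left _ _ (Ideal.subset_span ⟨s, rfl⟩)

variable {R : Type u} [CommRing R]

lemma length_pow_mul_le {d : ℕ} (x : Fin (d + 1) → R) (J : Ideal R) (n : ℕ) :
    Module.length R (R ⧸ ((Ideal.span (Set.range x)) ^ n * J)) ≤
      Module.length R (R ⧸ (Ideal.span (Set.range x)) ^ n) +
        ((n + d).choose d : ℕ) * Module.length R (R ⧸ J) := by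
  rw [← card_mono d n]
  refine length_upper (K := (Ideal.span (Set.range x)) ^ n * J) (L := (Ideal.span (Set.range x)) ^ n)
    (I := J) Ideal.mul_le_left (fun s : Mono (d + 1) n => xpow x s.1)
    ((span_pow_le x n).trans le_sup_right) ?_
  intro s c hc
  exact Ideal.mul_mem_mul_rev (xpow_mem x s) hc

lemma length_pow_le {d : ℕ} (x : Fin (d + 1) → R) (n : ℕ) :
    Module.length R (R ⧸ ((Ideal.span (Set.range x)) ^ n)) ≤
        ((n + d).choose (d + 1) : ℕ) * Module.length R (R ⧸ Ideal.span (Set.range x)) := by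
  induction n with
  | zero =>
    have : Subsingleton (R ⧸ (Ideal.span (Set.range x)) ^ 0) := by
      rw [pow_zero, Ideal.one_eq_top]; infer_instance
    simp [Module.length_eq_zero]
  | succ n ih =>
    rw [pow_succ]
    refine (length_pow_mul_le x _ n).trans ?_
    rw [show n + 1 + d = n + d + 1 by ring, Nat.choose_succ_succ, Nat.cast_add, add_mul, add_comm]
    gcongr

lemma le_length_pow {d : ℕ} (x : Fin (d + 1) → R) (hx : QuasiReg x) (n : ℕ) :
    ((n + d).choose (d + 1) : ℕ) * Module.length R (R ⧸ Ideal.span (Set.range x)) ≤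
    Module.length R (R ⧸ ((Ideal.span (Set.range x)) ^ n)) := by
  induction n with
  | zero => simp
  | succ n ih =>
    have := length_lower (K := (Ideal.span (Set.range x)) ^ (n + 1)) (L := (Ideal.span (Set.range x)) ^ n)
      (I := Ideal.span (Set.range x)) (Ideal.pow_le_pow_right (Nat.le_succ n))
      (fun s : Mono (d + 1) n => xpow x s.1) (xpow_mem x) (by
        intro c hc s
        rw [← polyOf_eval] at hc
        have := mem_map_C_iff.1 (hx n _ (polyOf_homog c) hc) s.1
        rwa [polyOf_coeff] at this)
    refine le_trans ?_ this
    rw [card_mono, show n + 1 + d = n + d + 1 by ring, Nat.choose_succ_succ, Nat.cast_add, add_mul,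
      add_comm]
    gcongr

end PowLengths

section Chain
open MvPolynomial

variable {R : Type u} [CommRing R] {B : Type u} [CommRing B] [Algebra R B]

/-- `φ⁻¹(Q^n W)` -/
def JW (Q : Ideal R) (n : ℕ) (W : Submodule R B) : Ideal R :=
  (Q ^ n • W).comap (Algebra.linearMap R B)

lemma mem_JW {Q : Ideal R} {n : ℕ} {W : Submodule R B} {r : R} :
    r ∈ JW Q n W ↔ algebraMap R B r ∈ Q ^ n • W := Iff.rfl

lemma JW_mono {Q : Ideal R} {n : ℕ} {W W' : Submodule R B} (h : W ≤ W') : JW Q n W ≤ JW Q n W' :=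
  Submodule.comap_mono (Submodule.smul_mono le_rfl h)

lemma JW_top (Q : Ideal R) (n : ℕ) :
    JW Q n (⊤ : Submodule R B) = contractedExt R (algebraMap R B) (Q ^ n) := by
  rw [JW, Ideal.smul_top_eq_map]; rfl

lemma JW_smul_top (Q : Ideal R) (n : ℕ) :
    JW Q n (Q • (⊤ : Submodule R B)) = JW Q (n + 1) (⊤ : Submodule R B) := by
  rw [JW, JW, ← Submodule.mul_smul, pow_succ]

lemma span_algebraMap {d : ℕ} (x : Fin d → R) :
    Ideal.span (Set.range fun i => algebraMap R B (x i)) =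
      (Ideal.span (Set.range x)).map (algebraMap R B) := by
  rw [Ideal.map_span, ← Set.range_comp]; rfl

lemma coeff_mem_of_eval_mem {d : ℕ} (x : Fin d → R)
    (hq : QuasiReg fun i => algebraMap R B (x i)) (W : Submodule R B)
    (hW : Ideal.span (Set.range x) • (⊤ : Submodule R B) ≤ W) (n : ℕ)
    (F : MvPolynomial (Fin d) B) (hF : F.IsHomogeneous n)
    (h : eval (fun i => algebraMap R B (x i)) F ∈ (Ideal.span (Set.range x)) ^ n • W) (s) :
    F.coeff s ∈ W := by
  obtain ⟨G, hG, hGW, he⟩ := (mem_pow_smul_iff x W n _).1 h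
  have h1 := hq n (F - G) (hF.sub hG) (by rw [map_sub, he, sub_self]; exact zero_mem _)
  have h2 := mem_map_C_iff.1 h1 s
  rw [span_algebraMap, coeff_sub] at h2
  have h3 : F.coeff s - G.coeff s ∈ W := hW (by rw [Ideal.smul_top_eq_map]; exact h2)
  simpa using W.add_mem h3 (hGW s)

lemma coeff_mem_maximalIdeal [IsLocalRing R] {d : ℕ} (W : Submodule R B)
    (P : MvPolynomial (Fin d) R) (F : MvPolynomial (Fin d) B) (hF : ∃ s, F.coeff s ∉ W)
    (h : ∀ s, (map (algebraMap R B) P * F).coeff s ∈ W) (s) : P.coeff s ∈ maximalIdeal R := by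
  classical
  by_contra hs
  set N : Submodule R B := Submodule.span R (F.support.image F.coeff : Finset B) with hN
  have hFN : ∀ s, F.coeff s ∈ N := by
    intro s
    by_cases h0 : F.coeff s = 0
    · rw [h0]; exact zero_mem _
    · exact Submodule.subset_span (by
        simp only [Finset.coe_image, Set.mem_image]
        exact ⟨s, by simpa using h0, rfl⟩)
  set W' := W ⊔ maximalIdeal R • N with hW'
  have hex : ∃ t, F.coeff t ∉ W' := by
    by_contra hcon
    push Not at hcon
    have h1 : N ≤ W := by
      refine Submodule.le_of_le_smul_of_le_jacobson_bot (I := maximalIdeal R) ?_ ?_ ?_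
      · exact ⟨_, rfl⟩
      · rw [IsLocalRing.jacobson_eq_maximalIdeal _ bot_ne_top]
      · rw [hN, Submodule.span_le]
        intro b hb
        simp only [Finset.coe_image, Set.mem_image] at hb
        obtain ⟨t, _, rfl⟩ := hb
        exact hcon t
    obtain ⟨t, ht⟩ := hF
    exact ht (h1 (hFN t))
  obtain ⟨t, ht⟩ := hex
  obtain ⟨b₀, hb₀, hbmax⟩ := Finset.exists_max_image
    (P.support.filter fun s => P.coeff s ∉ maximalIdeal R) (fun s => toLex s)
    ⟨s, by
      rw [Finset.mem_filter, mem_support_iff]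
      exact ⟨fun h0 => hs (by rw [h0]; exact zero_mem _), hs⟩⟩
  obtain ⟨a₀, ha₀, hamax⟩ := Finset.exists_max_image
    (F.support.filter fun s => F.coeff s ∉ W') (fun s => toLex s)
    ⟨t, by
      rw [Finset.mem_filter, mem_support_iff]
      exact ⟨fun h0 => ht (by rw [h0]; exact zero_mem _), ht⟩⟩
  have hb1 : ∀ b, toLex b₀ < toLex b → P.coeff b ∈ maximalIdeal R := by
    intro b hb
    by_contra hcon
    refine absurd (hbmax b ?_) (not_le.2 hb)
    rw [Finset.mem_filter, mem_support_iff]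
    exact ⟨fun h0 => hcon (by rw [h0]; exact zero_mem _), hcon⟩
  have ha1 : ∀ b, toLex a₀ < toLex b → F.coeff b ∈ W' := by
    intro b hb
    by_contra hcon
    refine absurd (hamax b ?_) (not_le.2 hb)
    rw [Finset.mem_filter, mem_support_iff]
    exact ⟨fun h0 => hcon (by rw [h0]; exact zero_mem _), hcon⟩
  have hc : (map (algebraMap R B) P * F).coeff (b₀ + a₀) ∈ W' := le_sup_left (a := W) (h _)
  rw [coeff_mul, ← Finset.add_sum_erase _ _ (a := (b₀, a₀)) (by simp)] at hc
  have hrest : ∑ z ∈ (Finset.HasAntidiagonal.antidiagonal (b₀ + a₀)).erase (b₀, a₀),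
      (map (algebraMap R B) P).coeff z.1 * F.coeff z.2 ∈ W' := by
    refine Submodule.sum_mem _ ?_
    rintro ⟨b, a⟩ hz
    rw [Finset.mem_erase, Finset.HasAntidiagonal.mem_antidiagonal] at hz
    obtain ⟨hne, hsum⟩ := hz
    simp only at hsum ⊢
    rw [coeff_map, ← Algebra.smul_def]
    rcases lt_trichotomy (toLex b₀) (toLex b) with hlt | heq | hgt
    · exact le_sup_right (a := W) (Submodule.smul_mem_smul (hb1 b hlt) (hFN a))
    · have heq' : b₀ = b := heq
      subst heq'
      exact absurd (by rw [add_left_cancel hsum]) hne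
    · refine W'.smul_mem _ (ha1 a ?_)
      have hsum' : toLex b + toLex a = toLex b₀ + toLex a₀ := hsum
      by_contra hcon
      exact absurd hsum' (add_lt_add_of_lt_of_le hgt (not_lt.1 hcon)).ne
  have hmain := (Submodule.add_mem_iff_left _ hrest).1 hc
  rw [coeff_map, ← Algebra.smul_def] at hmain
  rw [Finset.mem_filter] at ha₀ hb₀
  have hu : IsUnit (P.coeff b₀) := by
    by_contra hcon
    exact hb₀.2 ((mem_maximalIdeal _).2 hcon)
  exact ha₀.2 ((Submodule.smul_mem_iff_of_isUnit W' hu).1 hmain)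

lemma length_quot_maximalIdeal [IsLocalRing R] : Module.length R (R ⧸ maximalIdeal R) = 1 := by
  rw [Module.length_eq_one_iff]
  exact (isSimpleModule_iff_isCoatom).2 ((Ideal.isMaximal_def).1 inferInstance)

lemma chain_step [IsLocalRing R] {d : ℕ} (x : Fin (d + 1) → R)
    (hq : QuasiReg fun i => algebraMap R B (x i)) (W : Submodule R B)
    (hW : Ideal.span (Set.range x) • (⊤ : Submodule R B) ≤ W) (a : ℕ) (g : R)
    (hg : g ∈ JW (Ideal.span (Set.range x)) a (⊤ : Submodule R B))
    (hg' : g ∉ JW (Ideal.span (Set.range x)) a W) :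
    ∃ N : Submodule R B, N.FG ∧ ∀ n, a ≤ n →
      Module.length R (R ⧸ JW (Ideal.span (Set.range x)) n (W ⊔ N)) +
        ((n - a + d).choose d : ℕ) ≤ Module.length R (R ⧸ JW (Ideal.span (Set.range x)) n W) := by
  classical
  set Q := Ideal.span (Set.range x) with hQ
  obtain ⟨F, hF, -, he⟩ := (mem_pow_smul_iff x _ a _).1 hg
  have hex : ∃ s, F.coeff s ∉ W := by
    by_contra hcon
    push Not at hcon
    exact hg' ((mem_pow_smul_iff x _ a _).2 ⟨F, hF, hcon, he⟩)
  set N : Submodule R B := Submodule.span R (F.support.image F.coeff : Finset B) with hN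
  have hFN : ∀ s, F.coeff s ∈ N := by
    intro s
    by_cases h0 : F.coeff s = 0
    · rw [h0]; exact zero_mem _
    · exact Submodule.subset_span (by
        simp only [Finset.coe_image, Set.mem_image]
        exact ⟨s, by simpa using h0, rfl⟩)
  refine ⟨N, ⟨_, rfl⟩, fun n hn => ?_⟩
  have hgN : g ∈ JW Q a (W ⊔ N) :=
    (mem_pow_smul_iff x _ a _).2 ⟨F, hF, fun s => le_sup_right (a := W) (hFN s), he⟩
  have := length_lower (K := JW Q n W) (L := JW Q n (W ⊔ N)) (I := maximalIdeal R)
    (JW_mono le_sup_left) (fun s : Mono (d + 1) (n - a) => xpow x s.1 * g) (by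
      intro s
      have hp : Q ^ n = Q ^ (n - a) * Q ^ a := by rw [← pow_add, Nat.sub_add_cancel hn]
      rw [mem_JW, map_mul, ← Algebra.smul_def, hp, Submodule.mul_smul]
      exact Submodule.smul_mem_smul (xpow_mem x s) hgN) (by
      intro c hc s
      have h1 : eval (fun i => algebraMap R B (x i)) (map (algebraMap R B) (polyOf c) * F) =
          algebraMap R B (∑ s : Mono (d + 1) (n - a), c s * (xpow x s.1 * g)) := by
        rw [map_mul, he, eval_map]
        have h2 : eval₂ (algebraMap R B) (fun i => algebraMap R B (x i)) (polyOf c) =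
            algebraMap R B (eval x (polyOf c)) := by
          rw [eval₂_eq, eval_eq, map_sum]; simp
        rw [h2, polyOf_eval, Algebra.linearMap_apply, ← map_mul, Finset.sum_mul]
        simp only [mul_assoc]
      rw [mem_JW, ← h1] at hc
      have h3 : (map (algebraMap R B) (polyOf c) * F).IsHomogeneous n := by
        have := ((polyOf_homog c).map (algebraMap R B)).mul hF
        rwa [Nat.sub_add_cancel hn] at this
      have h4 := coeff_mem_of_eval_mem x hq W hW n _ h3 hc
      have h5 := coeff_mem_maximalIdeal W (polyOf c) F hex h4 s.1
      rwa [polyOf_coeff] at h5)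
  rw [length_quot_maximalIdeal, mul_one, card_mono] at this
  exact this

end Chain

section Asymp
open Filter Topology

lemma tendsto_choose_div (c k : ℕ) :
    Tendsto (fun n : ℕ => ((n + c).choose k : ℝ) / (n : ℝ) ^ k) atTop (𝓝 (1 / (k.factorial : ℝ))) := by
  have h1 : Tendsto (fun n : ℕ => ((n.choose k : ℝ)) / ((n : ℝ) ^ k / (k.factorial : ℝ))) atTop (𝓝 1) := by
    have := isEquivalent_choose k
    rw [Asymptotics.isEquivalent_iff_tendsto_one] at this
    · exact this
    · filter_upwards [eventually_gt_atTop 0] with n hn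
      positivity
  have h2 := h1.comp (tendsto_add_atTop_nat c)
  have h3 : Tendsto (fun n : ℕ => (((n + c : ℕ) : ℝ) / (n : ℝ)) ^ k) atTop (𝓝 (1 ^ k)) := by
    apply Tendsto.pow
    have : Tendsto (fun n : ℕ => 1 + (c : ℝ) / (n : ℝ)) atTop (𝓝 (1 + 0)) :=
      tendsto_const_nhds.add (tendsto_const_div_atTop_nhds_zero_nat _)
    rw [add_zero] at this
    refine this.congr' ?_
    filter_upwards [eventually_gt_atTop 0] with n hn
    push_cast
    field_simp
  have h4 := (h2.mul h3).mul_const (1 / (k.factorial : ℝ))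
  rw [one_pow, one_mul, one_mul] at h4
  refine h4.congr' ?_
  filter_upwards [eventually_gt_atTop 0] with n hn
  have : (k.factorial : ℝ) ≠ 0 := by positivity
  have h5 : ((n + c : ℕ) : ℝ) ≠ 0 := by positivity
  have h6 : (n : ℝ) ≠ 0 := by positivity
  simp only [Function.comp]
  rw [div_pow]
  field_simp

lemma tendsto_choose_div_zero (c k j : ℕ) (h : k < j) :
    Tendsto (fun n : ℕ => ((n + c).choose k : ℝ) / (n : ℝ) ^ j) atTop (𝓝 0) := by
  have h1 := tendsto_choose_div c k
  have h2 : Tendsto (fun n : ℕ => 1 / (n : ℝ) ^ (j - k)) atTop (𝓝 0) := by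
    have := (tendsto_pow_atTop (α := ℝ) (show j - k ≠ 0 by omega)).comp tendsto_natCast_atTop_atTop
    simp_rw [one_div]
    exact this.inv_tendsto_atTop
  have h3 := h1.mul h2
  rw [mul_zero] at h3
  refine h3.congr' ?_
  filter_upwards [eventually_gt_atTop 0] with n hn
  have h6 : (n : ℝ) ≠ 0 := by positivity
  rw [div_mul_div_comm, mul_one, ← pow_add, Nat.add_sub_cancel' h.le]

lemma le_of_choose_le (d a : ℕ) (s e : ℕ)
    (h : ∀ n : ℕ, s * (n + d).choose d ≤ e * (n + a).choose d) : s ≤ e := by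
  have h1 := (tendsto_choose_div d d).const_mul (s : ℝ)
  have h2 := (tendsto_choose_div a d).const_mul (e : ℝ)
  have h3 := le_of_tendsto_of_tendsto' h1 h2 (by
    intro n
    rw [← mul_div_assoc, ← mul_div_assoc]
    refine div_le_div_of_nonneg_right ?_ (by positivity)
    exact_mod_cast h n)
  have h4 : (0 : ℝ) < 1 / (d.factorial : ℝ) := by positivity
  exact_mod_cast le_of_mul_le_mul_right h3 h4

lemma final_asymp (d n0 N : ℕ) (e δ : ℤ) (E : ℕ → ℤ) (p : ℕ → ℤ) (hE1 : E 1 = 0)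
    (hp : ∀ n ≥ N, p n = ∑ i ∈ Finset.range (d + 1 + 1),
      (-1) ^ i * E i * ((n + (d + 1) - i).choose (d + 1 - i) : ℤ))
    (hlow : ∀ n ≥ N, e * ((n + d + 1).choose (d + 1) : ℤ) ≤ p (n + n0))
    (hup : ∀ n ≥ N, p n ≤ e * ((n + d + 1).choose (d + 1) : ℤ) - δ * ((n + d).choose d : ℤ)) :
    δ ≤ 0 := by
  -- rewrite the polynomial
  have hp' : ∀ n ≥ N, (p n : ℝ) = E 0 * ((n + (d + 1)).choose (d + 1) : ℝ) +
      ∑ i ∈ Finset.range d, (-1) ^ (i + 2) * E (i + 2) * ((n + (d - 1 - i)).choose (d - 1 - i) : ℝ) := by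
    intro n hn
    rw [hp n hn, Finset.sum_range_succ', Finset.sum_range_succ']
    push_cast
    simp only [zero_add, hE1, pow_zero, one_mul, Int.cast_zero, mul_zero, zero_mul, add_zero,
      Nat.sub_zero]
    rw [add_comm]
    congr 1
    refine Finset.sum_congr rfl fun i hi => ?_
    rw [Finset.mem_range] at hi
    rw [show n + (d + 1) - (i + 1 + 1) = n + (d - 1 - i) by omega,
      show d - (i + 1) = d - 1 - i by omega]
  have hrest : ∀ j, d - 1 < j → 0 < j → Tendsto (fun n : ℕ => (∑ i ∈ Finset.range d, (-1) ^ (i + 2) * E (i + 2) *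
      ((n + (d - 1 - i)).choose (d - 1 - i) : ℝ)) / (n : ℝ) ^ j) atTop (𝓝 0) := by
    intro j hj hj0
    simp_rw [Finset.sum_div, mul_div_assoc]
    rw [show (0 : ℝ) = ∑ i ∈ Finset.range d, (-1) ^ (i + 2) * E (i + 2) * (0 : ℝ) by simp]
    exact tendsto_finsetSum _ fun i _ => (tendsto_choose_div_zero _ _ _ (by omega)).const_mul _
  have hf : (0 : ℝ) < 1 / ((d + 1).factorial : ℝ) := by positivity
  have hf' : (0 : ℝ) < 1 / (d.factorial : ℝ) := by positivity
  have hplim : Tendsto (fun n : ℕ => (p n : ℝ) / (n : ℝ) ^ (d + 1)) atTop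
      (𝓝 (E 0 * (1 / ((d + 1).factorial : ℝ)))) := by
    have h1 := ((tendsto_choose_div (d + 1) (d + 1)).const_mul (E 0 : ℝ)).add
      (hrest (d + 1) (by omega) (by omega))
    rw [add_zero] at h1
    refine h1.congr' ?_
    filter_upwards [eventually_ge_atTop N] with n hn
    rw [hp' n hn, add_div, mul_div_assoc]
  have hE0 : e ≤ E 0 := by
    have h1 := hplim.comp (tendsto_add_atTop_nat n0)
    have h2 : Tendsto (fun n : ℕ => (e : ℝ) * (((n + d + 1).choose (d + 1) : ℝ) / (n : ℝ) ^ (d + 1)) *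
        ((n : ℝ) ^ (d + 1) / ((n + n0 : ℕ) : ℝ) ^ (d + 1))) atTop
        (𝓝 ((e : ℝ) * (1 / ((d + 1).factorial : ℝ)) * 1)) := by
      refine ((tendsto_choose_div (d + 1) (d + 1)).const_mul (e : ℝ)).mul ?_
      have h3 : Tendsto (fun n : ℕ => (((n : ℝ) / ((n + n0 : ℕ) : ℝ))) ^ (d + 1)) atTop (𝓝 (1 ^ (d + 1))) := by
        apply Tendsto.pow
        have : Tendsto (fun n : ℕ => (n : ℝ) / (n + (n0 : ℝ))) atTop (𝓝 1) :=
          tendsto_natCast_div_add_atTop (𝕜 := ℝ) (n0 : ℝ)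
        simpa using this
      simpa [div_pow] using h3
    rw [mul_one] at h2
    have h3 := le_of_tendsto_of_tendsto h2 h1 (by
      filter_upwards [eventually_ge_atTop N, eventually_gt_atTop 0] with n hn hn0
      have h6 : (n : ℝ) ^ (d + 1) ≠ 0 := by positivity
      have h7 : (e : ℝ) * (((n + d + 1).choose (d + 1) : ℝ) / (n : ℝ) ^ (d + 1)) *
        ((n : ℝ) ^ (d + 1) / ((n + n0 : ℕ) : ℝ) ^ (d + 1)) =
        (e * ((n + d + 1).choose (d + 1) : ℝ)) / ((n + n0 : ℕ) : ℝ) ^ (d + 1) := by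
        field_simp
      rw [h7]
      simp only [Function.comp]
      gcongr
      exact_mod_cast hlow n hn)
    exact_mod_cast le_of_mul_le_mul_right h3 hf
  by_contra hδ
  push Not at hδ
  have h1 := hrest d
  rcases Nat.eq_zero_or_pos d with rfl | hdpos
  · have h2 := hup N le_rfl
    have h3 := hp' N le_rfl
    simp at h3 h2
    have h4 : p N = E 0 * (N + 1) := by exact_mod_cast h3
    nlinarith
  · have h2 := h1 (by omega) hdpos
    have h3 := (tendsto_choose_div d d).const_mul (-δ : ℝ)
    have h4 := le_of_tendsto_of_tendsto h2 h3 (by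
      filter_upwards [eventually_ge_atTop N, eventually_gt_atTop 0] with n hn hn0
      rw [← mul_div_assoc]
      gcongr
      have h5 : (p n : ℝ) ≤ e * ((n + d + 1).choose (d + 1) : ℝ) - δ * ((n + d).choose d : ℝ) := by
        exact_mod_cast hup n hn
      have h6 := hp' n hn
      have h7 : (e : ℝ) * ((n + d + 1).choose (d + 1) : ℝ) ≤ E 0 * ((n + (d + 1)).choose (d + 1) : ℝ) := by
        rw [← add_assoc]
        gcongr
      linarith)
    have h5 : (0 : ℝ) < δ := by exact_mod_cast hδ
    nlinarith

end Asymp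

section ChainEnd
open MvPolynomial

variable {R : Type u} [CommRing R] {B : Type u} [CommRing B] [Algebra R B]

lemma pow_le_JW (Q : Ideal R) (n : ℕ) : Q ^ n ≤ JW Q n (⊤ : Submodule R B) := by
  intro r hr
  rw [mem_JW, Algebra.algebraMap_eq_smul_one]
  exact Submodule.smul_mem_smul hr trivial

lemma exists_good_W [IsLocalRing R] {d : ℕ} (x : Fin (d + 1) → R)
    (hq : QuasiReg fun i => algebraMap R B (x i)) (e : ℕ)
    (he : Module.length R (R ⧸ Ideal.span (Set.range x)) = e) :
    ∃ N : Submodule R B, N.FG ∧ ∀ n, JW (Ideal.span (Set.range x)) n (⊤ : Submodule R B) ≤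
      JW (Ideal.span (Set.range x)) n (Ideal.span (Set.range x) • (⊤ : Submodule R B) ⊔ N) := by
  set Q := Ideal.span (Set.range x) with hQ
  by_contra hcon
  push Not at hcon
  have key : ∀ s : ℕ, ∃ N : Submodule R B, N.FG ∧ ∃ a : ℕ, ∀ n, a ≤ n →
      Module.length R (R ⧸ JW Q n (Q • (⊤ : Submodule R B) ⊔ N)) +
        (s * (n - a + d).choose d : ℕ) ≤ Module.length R (R ⧸ JW Q (n + 1) (⊤ : Submodule R B)) := by
    intro s
    induction s with
    | zero => exact ⟨⊥, Submodule.fg_bot, 0, fun n _ => by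
        rw [sup_bot_eq, JW_smul_top]; simp⟩
    | succ s ih =>
      obtain ⟨N, hN, a, ha⟩ := ih
      obtain ⟨b, hb⟩ := hcon N hN
      obtain ⟨g, hg, hg'⟩ := Set.not_subset.1 hb
      obtain ⟨N', hN', h⟩ := chain_step x hq _ le_sup_left b g hg hg'
      refine ⟨N ⊔ N', hN.sup hN', max a b, fun n hn => ?_⟩
      have h1 := h n ((le_max_right _ _).trans hn)
      have h2 := ha n ((le_max_left _ _).trans hn)
      rw [← sup_assoc]
      refine le_trans ?_ h2
      refine le_trans ?_ (add_le_add_left h1 _)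
      rw [add_assoc, ← Nat.cast_add]
      gcongr
      rw [add_mul, one_mul, add_comm]
      gcongr
      · exact le_max_right _ _
      · exact le_max_left _ _
  obtain ⟨N, hN, a, ha⟩ := key (e + 1)
  have h1 : ∀ n, (((e + 1) * (n + (d + 1)).choose (d + 1) : ℕ) : ℕ∞) ≤
      Module.length R (R ⧸ JW Q (n + a + 1) (⊤ : Submodule R B)) := by
    intro n
    induction n with
    | zero =>
      have := ha a le_rfl
      simp only [Nat.sub_self, zero_add, Nat.choose_self, mul_one] at this ⊢
      rw [zero_add]
      exact le_add_self.trans this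
    | succ n ih =>
      have h2 := ha (n + 1 + a) (by omega)
      refine le_trans ?_ h2
      have h3 : Module.length R (R ⧸ JW Q (n + a + 1) (⊤ : Submodule R B)) ≤
          Module.length R (R ⧸ JW Q (n + 1 + a) (Q • (⊤ : Submodule R B) ⊔ N)) := by
        rw [show n + 1 + a = n + a + 1 by ring]
        exact length_quot_anti (JW_mono le_top)
      refine le_trans ?_ (add_le_add_left (ih.trans h3) _)
      rw [← Nat.cast_add, Nat.add_sub_cancel, ← mul_add]
      rw [show n + 1 + (d + 1) = n + (d + 1) + 1 by ring, Nat.choose_succ_succ,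
        show n + 1 + d = n + (d + 1) by ring, add_comm ((n + (d + 1)).choose d)]
  have h2 : e + 1 ≤ e := by
    refine le_of_choose_le (d + 1) (a + 1 + d) _ _ fun n => ?_
    have h3 := h1 n
    have h4 := length_pow_le x (n + a + 1)
    have h5 := length_quot_anti (pow_le_JW (B := B) Q (n + a + 1))
    rw [he] at h4
    have h6 := h3.trans (h5.trans h4)
    rw [← Nat.cast_mul, Nat.cast_le] at h6
    rw [mul_comm e, show n + (a + 1 + d) = n + a + 1 + d by ring]
    exact h6
  omega

/-- evaluation of a tuple of polynomials -/
noncomputable def tval {d p : ℕ} (x : Fin d → R) (w : Fin p → B) :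
    (Fin p → MvPolynomial (Fin d) R) →+ B where
  toFun f := ∑ j, algebraMap R B (eval x (f j)) * w j
  map_zero' := by simp
  map_add' f g := by simp [add_mul, Finset.sum_add_distrib]

lemma tval_apply {d p : ℕ} (x : Fin d → R) (w : Fin p → B) (f) :
    tval x w f = ∑ j, algebraMap R B (eval x (f j)) * w j := rfl

lemma tval_smul {d p : ℕ} (x : Fin d → R) (w : Fin p → B) (s : MvPolynomial (Fin d) R) (f) :
    tval x w (s • f) = eval x s • tval x w f := by
  rw [tval_apply, tval_apply, Finset.smul_sum]
  simp [Algebra.smul_def, mul_assoc]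

/-- homogeneous tuples representing elements of `J_n` -/
def NN {d p : ℕ} (x : Fin d → R) (w : Fin p → B) (n : ℕ) :
    Set (Fin p → MvPolynomial (Fin d) R) :=
  {f | (∀ j, (f j).IsHomogeneous n) ∧ ∃ r ∈ JW (Ideal.span (Set.range x)) n (⊤ : Submodule R B),
    tval x w f - algebraMap R B r ∈ (Ideal.span (Set.range x)) ^ (n + 1) • (⊤ : Submodule R B)}

lemma NN_smul {d p : ℕ} (x : Fin d → R) (w : Fin p → B) {n k : ℕ} {f} (hf : f ∈ NN x w n)
    {s : MvPolynomial (Fin d) R} (hs : s.IsHomogeneous k) : s • f ∈ NN x w (k + n) := by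
  obtain ⟨h1, r, hr, h2⟩ := hf
  have he : eval x s ∈ (Ideal.span (Set.range x)) ^ k :=
    (Ideal.mem_span_pow_iff_exists_isHomogeneous x _).2 ⟨s, hs, rfl⟩
  refine ⟨fun j => hs.mul (h1 j), eval x s * r, ?_, ?_⟩
  · rw [mem_JW, map_mul, ← Algebra.smul_def, pow_add, Submodule.mul_smul]
    exact Submodule.smul_mem_smul he hr
  · rw [map_mul, ← Algebra.smul_def, tval_smul, ← smul_sub, add_assoc, pow_add, Submodule.mul_smul]
    exact Submodule.smul_mem_smul he h2

lemma exists_NN {d p : ℕ} (x : Fin d → R) (w : Fin p → B) (n : ℕ) (r : R)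
    (hr : r ∈ JW (Ideal.span (Set.range x)) n (Ideal.span (Set.range x) • (⊤ : Submodule R B) ⊔
      Submodule.span R (Set.range w))) :
    ∃ f ∈ NN x w n, tval x w f - algebraMap R B r ∈
      (Ideal.span (Set.range x)) ^ (n + 1) • (⊤ : Submodule R B) := by
  have hr' : r ∈ JW (Ideal.span (Set.range x)) n (⊤ : Submodule R B) := JW_mono le_top hr
  rw [mem_JW, Submodule.smul_sup, ← Submodule.mul_smul, ← pow_succ] at hr
  obtain ⟨b, hb, c, hc, hbc⟩ := Submodule.mem_sup.1 hr
  rw [Submodule.mem_ideal_smul_span_iff_exists_sum] at hc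
  obtain ⟨a, ha, hsum⟩ := hc
  choose f hf hfa using fun j => (Ideal.mem_span_pow_iff_exists_isHomogeneous x _).1 (ha j)
  have h : tval x w f - algebraMap R B r ∈
      (Ideal.span (Set.range x)) ^ (n + 1) • (⊤ : Submodule R B) := by
    have : tval x w f = c := by
      rw [← hsum, tval_apply, Finsupp.sum_fintype _ _ (by simp)]
      simp [hfa, Algebra.smul_def]
    rw [this, ← hbc]
    simpa using hb
  exact ⟨f, ⟨hf, r, hr', h⟩, h⟩

lemma J_step [IsNoetherianRing R] [IsLocalRing R] {d : ℕ} (x : Fin (d + 1) → R)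
    (hq : QuasiReg fun i => algebraMap R B (x i)) (e : ℕ)
    (he : Module.length R (R ⧸ Ideal.span (Set.range x)) = e) :
    ∃ n0, ∀ n ≥ n0, JW (Ideal.span (Set.range x)) (n + 1) (⊤ : Submodule R B) ≤
      Ideal.span (Set.range x) * JW (Ideal.span (Set.range x)) n (⊤ : Submodule R B) ⊔
      JW (Ideal.span (Set.range x)) (n + 2) (⊤ : Submodule R B) := by
  obtain ⟨N, hN, hgood⟩ := exists_good_W (B := B) x hq e he
  obtain ⟨p, w, rfl⟩ := Submodule.fg_iff_exists_fin_generating_family.1 hN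
  set Q := Ideal.span (Set.range x) with hQ
  let S := MvPolynomial (Fin (d + 1)) R
  let T : ℕ →o Submodule S (Fin p → S) :=
    ⟨fun k => Submodule.span S (⋃ n ≤ k, NN x w n), fun k l hkl => Submodule.span_mono
      (Set.biUnion_subset_biUnion_left fun n (hn : n ≤ k) => hn.trans hkl)⟩
  obtain ⟨n0, hn0⟩ := monotone_stabilizes_iff_noetherian.2 (inferInstance : IsNoetherian S (Fin p → S)) T
  refine ⟨n0, fun n hn r hr => ?_⟩
  obtain ⟨f, hf, hfr⟩ := exists_NN x w (n + 1) r (hgood _ hr)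
  have hfT : f ∈ T n := by
    rw [← hn0 n hn, hn0 (n + 1) (by omega)]
    exact Submodule.subset_span (Set.mem_biUnion (le_refl (n + 1)) hf)
  -- the good property
  let Good : AddSubmonoid (Fin p → S) :=
    { carrier := {f | ∃ r' ∈ Q * JW Q n (⊤ : Submodule R B),
        tval x w f - algebraMap R B r' ∈ Q ^ (n + 2) • (⊤ : Submodule R B)}
      zero_mem' := ⟨0, zero_mem _, by simp⟩
      add_mem' := by
        rintro f g ⟨r, hr, h⟩ ⟨r', hr', h'⟩
        refine ⟨r + r', add_mem hr hr', ?_⟩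
        rw [map_add, map_add, add_sub_add_comm]
        exact add_mem h h' }
  let comp : (Fin p → S) →ₗ[R] (Fin p → S) :=
    LinearMap.pi fun j => (homogeneousComponent (n + 1)).comp (LinearMap.proj j)
  have hcompf : comp f = f := by
    funext j
    exact (homogeneousComponent_of_mem (hf.1 j)).trans (if_pos rfl)
  have hmono : ∀ (m : ℕ) (g) (_ : m ≤ n) (_ : g ∈ NN x w m) (u : Fin (d + 1) →₀ ℕ) (c : R),
      comp ((monomial u c : S) • g) ∈ Good := by
    intro m g hm hg u c
    have hh := NN_smul x w hg (isHomogeneous_monomial c (rfl : u.degree = u.degree))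
    by_cases hdeg : u.degree + m = n + 1
    · have e1 : comp ((monomial u c : S) • g) = (monomial u c : S) • g := by
        funext j
        exact (homogeneousComponent_of_mem (hh.1 j)).trans (if_pos hdeg.symm)
      rw [e1]
      have hu : u ≠ 0 := by
        rintro rfl
        simp at hdeg
        omega
      obtain ⟨i, hi⟩ := Finsupp.ne_iff.1 hu
      have hle : Finsupp.single i 1 ≤ u := by
        rw [Finsupp.single_le_iff]
        exact Nat.one_le_iff_ne_zero.2 hi
      have hd' : (u - Finsupp.single i 1).degree + 1 = u.degree := by
        have := congrArg Finsupp.degree (tsub_add_cancel_of_le hle)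
        rwa [map_add, Finsupp.degree_single] at this
      have e2 : (monomial u c : S) = X i * monomial (u - Finsupp.single i 1) c := by
        rw [X, monomial_mul, one_mul, add_tsub_cancel_of_le hle]
      have hF := NN_smul x w hg (isHomogeneous_monomial c
        (show (u - Finsupp.single i 1).degree = n - m by omega))
      rw [Nat.sub_add_cancel hm] at hF
      obtain ⟨-, r1, hr1, hr1'⟩ := hF
      refine ⟨x i * r1, Ideal.mul_mem_mul (Ideal.subset_span ⟨i, rfl⟩) hr1, ?_⟩
      rw [e2, mul_smul, tval_smul, eval_X, map_mul, ← Algebra.smul_def, ← smul_sub,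
        show n + 2 = (n + 1) + 1 by ring, pow_succ', Submodule.mul_smul]
      exact Submodule.smul_mem_smul (Ideal.subset_span ⟨i, rfl⟩) hr1'
    · have e1 : comp ((monomial u c : S) • g) = 0 := by
        funext j
        exact (homogeneousComponent_of_mem (hh.1 j)).trans (if_neg fun h => hdeg h.symm)
      rw [e1]; exact zero_mem _
  have hfG : comp f ∈ Good := by
    obtain ⟨l, s, g, hs⟩ := Submodule.mem_span_set'.1 hfT
    rw [← hs, map_sum]
    refine sum_mem fun i _ => ?_
    obtain ⟨m, hm, hg⟩ := Set.mem_iUnion₂.1 (g i).2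
    rw [(s i).as_sum, Finset.sum_smul, map_sum]
    exact sum_mem fun u _ => hmono m _ hm hg u _
  rw [hcompf] at hfG
  obtain ⟨r', hr', h⟩ := hfG
  refine Submodule.mem_sup.2 ⟨r', hr', r - r', ?_, by ring⟩
  rw [mem_JW, map_sub]
  have := sub_mem h hfr
  simpa using this

end ChainEnd

section E0
variable {R : Type u} [CommRing R]

open MvPolynomial in
theorem adicCompletion_noetherian [IsNoetherianRing R] (m : Ideal R) :
    IsNoetherianRing (AdicCompletion m R) := by
  classical
  obtain ⟨s, hs⟩ := (Ideal.fg_of_isNoetherianRing m)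
  let σ := {x // x ∈ s}
  let P := MvPolynomial σ R
  let V : Ideal P := idealOfVars σ R
  let g : P →ₐ[R] R := aeval (fun i : σ => (i : R))
  have hgC : ∀ r : R, g (C r) = r := fun r => aeval_C _ r
  have hgX : ∀ i : σ, g.toRingHom (X i) = i := fun i => aeval_X _ i
  have hg : Function.Surjective g.toRingHom := fun r => ⟨C r, hgC r⟩
  have hV : V.map g.toRingHom = m := by
    rw [← hs]
    simp only [V, idealOfVars, Ideal.map_span]
    congr 1
    ext r
    constructor
    · rintro ⟨_, ⟨i, rfl⟩, rfl⟩
      rw [hgX]; exact i.2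
    · intro h
      exact ⟨_, ⟨⟨r, h⟩, rfl⟩, hgX _⟩
  have hVk : ∀ k, (V ^ k).map g.toRingHom = m ^ k := fun k => by rw [Ideal.map_pow, hV]
  have : IsNoetherianRing (AdicCompletion V P) :=
    isNoetherianRing_of_surjective _ _
      (MvPowerSeries.toAdicCompletionAlgEquiv σ R).toRingEquiv.toRingHom
      (MvPowerSeries.toAdicCompletionAlgEquiv σ R).surjective
  let q : ∀ k, P ⧸ V ^ k →+* R ⧸ m ^ k := fun k =>
    Ideal.quotientMap (m ^ k) g.toRingHom (by rw [← hVk k]; exact Ideal.le_comap_map)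
  have hq : ∀ k p, q k (Ideal.Quotient.mk _ p) = Ideal.Quotient.mk _ (g p) := fun k p => rfl
  let f : ∀ k, AdicCompletion V P →+* R ⧸ m ^ k := fun k =>
    (q k).comp (AdicCompletion.evalₐ V k).toRingHom
  have hf : ∀ {a b : ℕ} (hle : a ≤ b), (Ideal.Quotient.factorPow m hle).comp (f b) = f a := by
    intro a b hle
    ext x
    induction x using AdicCompletion.induction_on with
    | h x =>
    have e1 : f b (AdicCompletion.mk V P x) = Ideal.Quotient.mk _ (g (x.val b)) := by
      simp only [f, RingHom.comp_apply, AlgHom.toRingHom_eq_coe, RingHom.coe_coe, AdicCompletion.evalₐ_mk, hq]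
    have e2 : f a (AdicCompletion.mk V P x) = Ideal.Quotient.mk _ (g (x.val b)) := by
      simp only [f, RingHom.comp_apply, AlgHom.toRingHom_eq_coe, RingHom.coe_coe, AdicCompletion.evalₐ_mk]
      rw [← AdicCompletion.Ideal.mk_eq_mk V hle, hq]
    rw [RingHom.comp_apply, e1, e2]
    rfl
  refine isNoetherianRing_of_surjective _ _ (AdicCompletion.liftRingHom m f hf) ?_
  intro y
  induction y using AdicCompletion.induction_on with
  | h a =>
  have hd : ∀ k, ∃ p ∈ V ^ k, g p = a.val (k+1) - a.val k := by
    intro k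
    have h1 : a.val (k+1) - a.val k ∈ m ^ k := by
      rw [← Ideal.Quotient.eq]
      exact AdicCompletion.Ideal.mk_eq_mk m (Nat.le_succ k) a
    rw [← hVk k] at h1
    exact (Ideal.mem_map_iff_of_surjective _ hg).1 h1
  choose p hp hpa using hd
  let b : ℕ → P := fun k => C (a.val 0) + ∑ j ∈ Finset.range k, p j
  have hb : ∀ k, g (b k) = a.val k := by
    intro k
    induction k with
    | zero => simp only [b, Finset.range_zero, Finset.sum_empty, add_zero, hgC]
    | succ k ih =>
      have : b (k+1) = b k + p k := by simp only [b, Finset.sum_range_succ]; ring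
      rw [this, map_add, ih, hpa]; ring
  let c : AdicCompletion.AdicCauchySequence V P := AdicCompletion.AdicCauchySequence.mk V P b (by
    intro k
    have : b (k+1) = b k + p k := by simp only [b, Finset.sum_range_succ]; ring
    rw [SModEq.comm, SModEq.sub_mem, this, add_sub_cancel_left]
    simpa using hp k)
  refine ⟨AdicCompletion.mk V P c, AdicCompletion.ext_evalₐ fun k => ?_⟩
  rw [AdicCompletion.evalₐ_liftRingHom, AdicCompletion.evalₐ_mk]
  simp only [f, RingHom.comp_apply, AlgHom.toRingHom_eq_coe, RingHom.coe_coe, AdicCompletion.evalₐ_mk, hq]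
  congr 1
  exact hb k
end E0

section E1
theorem eq_zero_of_integral_div {C : Type*} [CommRing C] [IsDomain C] [IsNoetherianRing C]
    {K : Type*} [Field K] [Algebra C K] (hinj : Function.Injective (algebraMap C K))
    (x z : C) (hx0 : x ≠ 0) (hx : ¬ IsUnit x)
    (hz : ∀ n, 0 < n → IsIntegral C (algebraMap C K z / algebraMap C K x ^ n)) : z = 0 := by
  by_contra hz0
  have htop : Ideal.span {x} ≠ ⊤ := by rwa [Ne, Ideal.span_singleton_eq_top]
  obtain ⟨P, hP⟩ := Ideal.nonempty_minimalPrimes htop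
  have hPp : P.IsPrime := hP.isPrime
  have hht : P.height ≤ 1 := Ideal.height_le_one_of_isPrincipal_of_mem_minimalPrimes (Ideal.span {x}) P hP
  let L := Localization.AtPrime P
  have hunit : ∀ y : P.primeCompl, IsUnit (algebraMap C K y) := by
    intro y
    rw [isUnit_iff_ne_zero]
    intro h
    have : (y : C) = 0 := hinj (by rw [h, map_zero])
    exact y.2 (this ▸ P.zero_mem)
  let j : L →+* K := IsLocalization.lift (M := P.primeCompl) hunit
  have hj : ∀ c : C, j (algebraMap C L c) = algebraMap C K c := fun c => IsLocalization.lift_eq hunit c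
  have hjinj : Function.Injective j := by
    rw [injective_iff_map_eq_zero]
    intro a ha
    obtain ⟨c, s, rfl⟩ := IsLocalization.exists_mk'_eq P.primeCompl a
    have h1 := congrArg j (IsLocalization.mk'_spec L c s)
    rw [map_mul, ha, zero_mul, hj] at h1
    have : c = 0 := hinj (by rw [← h1, map_zero])
    rw [this, IsLocalization.mk'_zero]
  letI : Algebra L K := j.toAlgebra
  haveI : IsScalarTower C L K := IsScalarTower.of_algebraMap_eq fun c => (hj c).symm
  have hzL : algebraMap C L z ≠ 0 := by
    intro h
    have := hj z
    rw [h, map_zero] at this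
    exact hz0 (hinj (by rw [← this, map_zero]))
  have hdim : Ring.KrullDimLE 1 L := by
    rw [Ring.krullDimLE_iff, IsLocalization.AtPrime.ringKrullDim_eq_height P L]
    exact_mod_cast hht
  haveI : IsDomain L := hjinj.isDomain
  have hxm : algebraMap C L x ∈ maximalIdeal L := by
    rw [← Localization.AtPrime.map_eq_maximalIdeal]
    exact Ideal.mem_map_of_mem _ (hP.1.2 (Ideal.mem_span_singleton_self x))
  have hrad : algebraMap C L x ∈ (Ideal.span {algebraMap C L z}).radical := by
    rw [Ideal.radical_eq_sInf, Ideal.mem_sInf]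
    rintro p ⟨hp, hpp⟩
    have hne : p ≠ ⊥ := by
      rintro rfl
      exact hzL (by simpa using hp (Ideal.mem_span_singleton_self _))
    have := Ideal.isMaximal_of_isPrime_of_ne_bot p hne
    rw [IsLocalRing.eq_maximalIdeal this]
    exact hxm
  obtain ⟨s, hs⟩ := hrad
  obtain ⟨w, hw⟩ := Ideal.mem_span_singleton'.1 hs
  have hxK : algebraMap C K x ≠ 0 := fun h => hx0 (hinj (by rw [h, map_zero]))
  have hInt : IsIntegral L (algebraMap C K x)⁻¹ := by
    have h1 : IsIntegral L (algebraMap C K z / algebraMap C K x ^ (s+1)) :=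
      (hz (s+1) (Nat.succ_pos s)).tower_top
    have h2 := (isIntegral_algebraMap (R := L) (A := K) (x := w)).mul h1
    have h3 : algebraMap L K w * (algebraMap C K z) = algebraMap C K x ^ s := by
      have := congrArg j hw
      rw [map_mul, map_pow, hj, hj] at this
      exact this
    have h4 : algebraMap L K w * (algebraMap C K z / algebraMap C K x ^ (s+1)) = (algebraMap C K x)⁻¹ := by
      rw [← mul_div_assoc, h3, pow_succ]
      field_simp
    rwa [h4] at h2
  haveI : FaithfulSMul L K := (faithfulSMul_iff_algebraMap_injective L K).2 hjinj
  let I := integralClosure L K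
  have hu : IsUnit (algebraMap L I (algebraMap C L x)) := by
    refine IsUnit.of_mul_eq_one (⟨_, hInt⟩ : I) (Subtype.ext ?_)
    change j (algebraMap C L x) * (algebraMap C K x)⁻¹ = 1
    rw [hj, mul_inv_cancel₀ hxK]
  have hinjI : Function.Injective (algebraMap L I) := by
    intro a b hab
    exact hjinj (congrArg Subtype.val hab)
  haveI := (algebraMap_isIntegral_iff.2 (inferInstance : Algebra.IsIntegral L I)).isLocalHom hinjI
  exact hxm ((isUnit_map_iff (algebraMap L I) _).1 hu)
end E1

section E2
theorem exists_pow_le_succ {A : Type*} [CommRing A] (Q : Ideal A) (t : Finset A)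
    (ht : (t : Set A) ⊆ Q) (h : ∀ x ∈ t, ∃ k, x ^ k ∈ Q ^ (k+1)) :
    ∃ N, (Ideal.span (t : Set A)) ^ N ≤ Q ^ (N+1) := by
  classical
  induction t using Finset.induction_on with
  | empty => exact ⟨1, by simp⟩
  | insert x t hx ih =>
    obtain ⟨N, hN⟩ := ih (fun y hy => ht (by simp [Finset.mem_coe.1 hy])) (fun y hy => h y (by simp [hy]))
    obtain ⟨k, hk⟩ := h x (by simp)
    have hxQ : Ideal.span {x} ≤ Q := by
      rw [Ideal.span_singleton_le_iff_mem]; exact ht (by simp)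
    have htQ : Ideal.span (t : Set A) ≤ Q := Ideal.span_le.2 (fun y hy => ht (by simp [Finset.mem_coe.1 hy]))
    have hk' : (Ideal.span {x}) ^ k ≤ Q ^ (k+1) := by
      rw [Ideal.span_singleton_pow, Ideal.span_singleton_le_iff_mem]; exact hk
    refine ⟨k + N, ?_⟩
    rw [Finset.coe_insert, Ideal.span_insert, ← Submodule.add_eq_sup, add_pow, ]
    rw [Ideal.sum_eq_sup, Finset.sup_le_iff]
    intro i hi
    have hi' : i ≤ k + N := by simpa [Nat.lt_succ_iff] using hi
    refine Ideal.mul_le_left.trans ?_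
    by_cases hik : k ≤ i
    · obtain ⟨c, rfl⟩ := Nat.exists_eq_add_of_le hik
      rw [pow_add]
      calc _ ≤ (Q ^ (k+1) * Q ^ c) * Q ^ (k + N - (k+c)) :=
            Ideal.mul_mono (Ideal.mul_mono hk' (Ideal.pow_right_mono hxQ c)) (Ideal.pow_right_mono htQ _)
        _ = _ := by rw [← pow_add, ← pow_add]; congr 1; omega
    · obtain ⟨c, hc⟩ : ∃ c, k + N - i = N + c := ⟨k - i, by omega⟩
      rw [hc, pow_add]
      calc _ ≤ Q ^ i * (Q ^ (N+1) * Q ^ c) :=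
            Ideal.mul_mono (Ideal.pow_right_mono hxQ _) (Ideal.mul_mono hN (Ideal.pow_right_mono htQ c))
        _ = _ := by rw [← pow_add, ← pow_add]; congr 1; omega

theorem eq_zero_of_int_domain {D : Type*} [CommRing D] [IsDomain D] [IsNoetherianRing D]
    (Q : Ideal D) (hQ0 : Q ≠ ⊥) (hQ : Q ≤ (⊥ : Ideal D).jacobson) (z : D)
    (hz : ∀ n, 0 < n → ∃ r ∈ intClSet D (Q ^ n), ∃ q ∈ Q ^ n, z = r + q) : z = 0 := by
  classical
  obtain ⟨s, hs⟩ := Ideal.fg_of_isNoetherianRing Q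
  have hsQ : (s : Set D) ⊆ Q := hs ▸ Ideal.subset_span
  obtain ⟨x, hxs, hxk⟩ : ∃ x ∈ s, ∀ k, x ^ k ∉ Q ^ (k+1) := by
    by_contra! hcon
    obtain ⟨N, hN⟩ := exists_pow_le_succ Q s hsQ hcon
    rw [hs] at hN
    have : Q ^ N = ⊥ := by
      refine Submodule.eq_bot_of_le_smul_of_le_jacobson_bot Q (Q ^ N) (Ideal.fg_of_isNoetherianRing _) ?_ hQ
      rw [smul_eq_mul, ← pow_succ']; exact hN
    exact hQ0 (pow_eq_zero_iff (n := N) (by rintro rfl; rw [pow_zero, Ideal.one_eq_top] at this; exact top_ne_bot this) |>.1 this)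
  have hxQ : x ∈ Q := hsQ hxs
  have hx0 : x ≠ 0 := by
    rintro rfl; exact hxk 1 (by simp)
  let K := FractionRing D
  let φ := algebraMap D K
  have hφ : Function.Injective φ := IsFractionRing.injective D K
  have hxK : φ x ≠ 0 := fun h => hx0 (hφ (by rw [h, map_zero]))
  let t : Finset K := s.image (fun y => φ y / φ x)
  let C : Subalgebra D K := Algebra.adjoin D (t : Set K)
  haveI : IsNoetherianRing C := by
    have : Algebra.FiniteType D C := (Subalgebra.fg_iff_finiteType C).1 ⟨t, rfl⟩
    exact Algebra.FiniteType.isNoetherianRing D C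
  have hCpow : ∀ c ∈ C, ∃ k, ∃ a ∈ Q ^ k, c * φ x ^ k = φ a := by
    intro c hc
    induction hc using Algebra.adjoin_induction with
    | mem c hc =>
      simp only [t, Finset.coe_image, Set.mem_image] at hc
      obtain ⟨y, hy, rfl⟩ := hc
      exact ⟨1, y, by simpa using hsQ hy, by rw [pow_one, div_mul_cancel₀ _ hxK]⟩
    | algebraMap r => exact ⟨0, r, by simp, by simp [φ]⟩
    | add c c' _ _ h h' =>
      obtain ⟨k, a, ha, e⟩ := h
      obtain ⟨k', a', ha', e'⟩ := h'
      refine ⟨k + k', a * x ^ k' + a' * x ^ k, Ideal.add_mem _ ?_ ?_, ?_⟩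
      · rw [pow_add]; exact Ideal.mul_mem_mul ha (Ideal.pow_mem_pow hxQ _)
      · rw [add_comm, pow_add]; exact Ideal.mul_mem_mul ha' (Ideal.pow_mem_pow hxQ _)
      · rw [map_add, map_mul, map_mul, map_pow, map_pow, ← e, ← e']; ring
    | mul c c' _ _ h h' =>
      obtain ⟨k, a, ha, e⟩ := h
      obtain ⟨k', a', ha', e'⟩ := h'
      refine ⟨k + k', a * a', ?_, ?_⟩
      · rw [pow_add]; exact Ideal.mul_mem_mul ha ha'
      · rw [map_mul, ← e, ← e']; ring
  have hQC : ∀ k, ∀ a ∈ Q ^ k, φ a / φ x ^ k ∈ C := by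
    have h1 : ∀ a ∈ Q, φ a / φ x ∈ C := by
      intro a ha
      rw [← hs] at ha
      induction ha using Submodule.span_induction with
      | mem a ha => exact Algebra.subset_adjoin (by simp only [t, Finset.coe_image]; exact ⟨a, ha, rfl⟩)
      | zero => simp
      | add a b _ _ h h' => rw [map_add, add_div]; exact C.add_mem h h'
      | smul r a _ h =>
        rw [smul_eq_mul, map_mul, mul_div_assoc]
        exact C.mul_mem (C.algebraMap_mem r) h
    intro k
    induction k with
    | zero => intro a _; rw [pow_zero, div_one]; exact C.algebraMap_mem a
    | succ k ih =>
      intro a ha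
      rw [pow_succ] at ha
      induction ha using Submodule.mul_induction_on' with
      | mem_mul_mem a ha b hb =>
        have : φ (a * b) / φ x ^ (k+1) = (φ a / φ x ^ k) * (φ b / φ x) := by
          rw [map_mul, pow_succ, div_mul_div_comm]
        rw [this]; exact C.mul_mem (ih a ha) (h1 b hb)
      | add a _ b _ h h' => rw [map_add, add_div]; exact C.add_mem h h'
  have hinjC : Function.Injective (algebraMap C K) := Subtype.val_injective
  let xC : C := algebraMap D C x
  let zC : C := algebraMap D C z
  have hxC : algebraMap C K xC = φ x := rfl
  have hzC : algebraMap C K zC = φ z := rfl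
  have hfin : zC = 0 := by
    refine eq_zero_of_integral_div (K := K) hinjC xC zC ?_ ?_ ?_
    · intro h; exact hxK (by rw [← hxC, h, map_zero])
    · intro h
      obtain ⟨c, hc⟩ := h.exists_right_inv
      obtain ⟨k, a, ha, e⟩ := hCpow c c.2
      have hc' : φ x * (c : K) = 1 := congrArg Subtype.val hc
      refine hxk k ?_
      have : x ^ k = a * x := hφ (by
        rw [map_mul, map_pow, ← e]
        linear_combination (- φ x ^ k) * hc')
      rw [this, pow_succ]; exact Ideal.mul_mem_mul ha hxQ
    · intro n hn
      obtain ⟨r, ⟨N, hN, a, ha, hr⟩, q, hq, rfl⟩ := hz n hn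
      rw [hzC, hxC, map_add, add_div]
      refine IsIntegral.add ?_ ?_
      · have hb : ∀ k : ℕ, ∃ b : C, k ∈ Finset.Icc 1 N → (b : K) = φ (a k) / φ x ^ (n * k) := by
          intro k
          by_cases hk : k ∈ Finset.Icc 1 N
          · exact ⟨⟨_, hQC (n*k) (a k) (by rw [pow_mul]; exact ha k hk)⟩, fun _ => rfl⟩
          · exact ⟨0, fun h => (hk h).elim⟩
        choose b hb using hb
        refine ⟨Polynomial.X ^ N + ∑ k ∈ Finset.Icc 1 N, Polynomial.C (b k) * Polynomial.X ^ (N - k), ?_, ?_⟩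
        · refine Polynomial.monic_X_pow_add ?_
          refine (Polynomial.degree_sum_le _ _).trans_lt ?_
          refine (Finset.sup_lt_iff (WithBot.bot_lt_coe N)).2 ?_
          intro k hk
          refine (Polynomial.degree_C_mul_X_pow_le _ _).trans_lt ?_
          rw [Finset.mem_Icc] at hk
          exact WithBot.coe_lt_coe.2 (show N - k < N by omega)
        · rw [Polynomial.eval₂_add, Polynomial.eval₂_pow, Polynomial.eval₂_X, Polynomial.eval₂_finset_sum]
          have h2 : φ r ^ N + ∑ k ∈ Finset.Icc 1 N, φ (a k) * φ r ^ (N - k) = 0 := by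
            have := congrArg φ hr
            simpa [map_add, map_sum] using this
          have h3 : (φ r / φ x ^ n) ^ N + ∑ k ∈ Finset.Icc 1 N, (φ (a k) / φ x ^ (n*k)) * (φ r / φ x ^ n) ^ (N - k) = (φ r ^ N + ∑ k ∈ Finset.Icc 1 N, φ (a k) * φ r ^ (N - k)) / φ x ^ (n * N) := by
            rw [add_div, Finset.sum_div]
            congr 1
            · rw [div_pow, pow_mul]
            · refine Finset.sum_congr rfl fun k hk => ?_
              rw [Finset.mem_Icc] at hk
              rw [div_pow, div_mul_div_comm, ← pow_mul, ← pow_add, ← mul_add]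
              congr 3; omega
          rw [h2, zero_div] at h3
          rw [← h3]
          congr 1
          refine Finset.sum_congr rfl fun k hk => ?_
          rw [Polynomial.eval₂_mul, Polynomial.eval₂_C, Polynomial.eval₂_pow, Polynomial.eval₂_X]
          congr 1
          exact hb k hk
      · exact isIntegral_algebraMap (R := C) (x := ⟨_, hQC n q hq⟩)
  exact hφ (by rw [← hzC, hfin, map_zero, map_zero])

theorem intClSet_map {A A' : Type*} [CommRing A] [CommRing A'] (f : A →+* A') (I : Ideal A) (r : A)
    (hr : r ∈ intClSet A I) : f r ∈ intClSet A' (I.map f) := by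
  obtain ⟨N, hN, a, ha, hr⟩ := hr
  refine ⟨N, hN, fun k => f (a k), fun k hk => ?_, ?_⟩
  · rw [← Ideal.map_pow]; exact Ideal.mem_map_of_mem f (ha k hk)
  · have := congrArg f hr
    simpa [map_add, map_sum] using this

theorem isNilpotent_of_int {A : Type*} [CommRing A] [IsNoetherianRing A] [IsLocalRing A]
    (Q : Ideal A) (hQ : Q ≤ maximalIdeal A) (z : A)
    (hz : ∀ n, 0 < n → ∃ r ∈ intClSet A (Q ^ n), ∃ q ∈ Q ^ n, z = r + q) : IsNilpotent z := by
  rw [← mem_nilradical, nilradical_eq_sInf, Ideal.mem_sInf]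
  intro P hP
  have hP : P.IsPrime := hP
  by_cases hQP : Q ≤ P
  · obtain ⟨r, ⟨N, hN, a, ha, hr⟩, q, hq, rfl⟩ := hz 1 one_pos
    rw [pow_one] at ha hq
    refine P.add_mem (hP.mem_of_pow_mem N ?_) (hQP hq)
    rw [eq_neg_of_add_eq_zero_left hr]
    refine P.neg_mem (P.sum_mem fun k hk => P.mul_mem_right _ ?_)
    rw [Finset.mem_Icc] at hk
    exact hQP (Ideal.pow_le_self (by omega) (ha k (Finset.mem_Icc.2 hk)))
  · rw [← Ideal.Quotient.eq_zero_iff_mem]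
    haveI : Nontrivial (A ⧸ P) := Ideal.Quotient.nontrivial_iff.2 hP.ne_top
    haveI : IsLocalRing (A ⧸ P) := .of_surjective' _ Ideal.Quotient.mk_surjective
    haveI : IsLocalHom (Ideal.Quotient.mk P) := .of_surjective _ Ideal.Quotient.mk_surjective
    refine eq_zero_of_int_domain (Q.map (Ideal.Quotient.mk P)) ?_ ?_ _ ?_
    · rw [Ne, Ideal.map_eq_bot_iff_le_ker, Ideal.mk_ker]; exact hQP
    · rw [IsLocalRing.jacobson_eq_maximalIdeal _ bot_ne_top]
      exact (Ideal.map_mono hQ).trans (((local_hom_TFAE (Ideal.Quotient.mk P)).out 0 2).1 (by assumption))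
    · intro n hn
      obtain ⟨r, hr, q, hq, rfl⟩ := hz n hn
      rw [← Ideal.map_pow]
      exact ⟨_, intClSet_map _ _ _ hr, _, Ideal.mem_map_of_mem _ hq, map_add _ _ _⟩
end E2

section E3
variable {R : Type u} [CommRing R] [IsNoetherianRing R] [IsLocalRing R]

theorem isArtinian_quot_of_radical (I : Ideal R) (h : I.radical = maximalIdeal R) :
    IsArtinian R (R ⧸ I) := by
  have hm : maximalIdeal R ∈ I.minimalPrimes := by
    refine ⟨⟨inferInstance, h ▸ Ideal.le_radical⟩, ?_⟩
    rintro p ⟨hp, hpI⟩ _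
    rw [← h]
    exact hp.radical_le_iff.2 hpI
  have h1 := IsLocalRing.quotient_artinian_of_mem_minimalPrimes_of_isLocalRing I hm
  exact isArtinian_of_surjective_algebraMap (S := R) (R := R ⧸ I) (M := R ⧸ I) Ideal.Quotient.mk_surjective

theorem chevalley (hred : IsReduced (AdicCompletion (maximalIdeal R) R))
    (Q : Ideal R) (hQ : Q.radical = maximalIdeal R) (J : ℕ → Ideal R) (hJ : Antitone J)
    (hInt : ∀ n, 0 < n → ∀ r ∈ J n, r ∈ intClSet R (Q ^ n)) (l : ℕ) :
    ∃ n, J n ≤ maximalIdeal R ^ l := by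
  set m := maximalIdeal R with hm
  by_cases hl : l = 0
  · subst hl; exact ⟨0, by simp⟩
  by_contra! hcon
  have hstab : ∀ k : ℕ, 0 < k → ∃ s, ∀ n, J s ≤ J n ⊔ m ^ k := by
    intro k hk
    have : IsArtinian R (R ⧸ m ^ k) := isArtinian_quot_of_radical _ (by
      rw [Ideal.radical_pow _ hk.ne']; exact (maximalIdeal.isMaximal R).isPrime.radical)
    let f : ℕ →o (Submodule R (R ⧸ m ^ k))ᵒᵈ :=
      ⟨fun n => OrderDual.toDual (Submodule.map (Submodule.mkQ (m ^ k)) (J n)), fun a b hab => by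
        exact Submodule.map_mono (hJ hab)⟩
    obtain ⟨s, hs⟩ := IsArtinian.monotone_stabilizes f
    refine ⟨s, fun n => ?_⟩
    rcases le_total n s with h | h
    · exact (hJ h).trans le_sup_left
    · have h1 : Submodule.map (Submodule.mkQ (m ^ k)) (J s) = Submodule.map (Submodule.mkQ (m ^ k)) (J n) := hs n h
      have h2 := congrArg (Submodule.comap (Submodule.mkQ (m ^ k))) h1
      rw [Submodule.comap_map_mkQ, Submodule.comap_map_mkQ] at h2
      calc J s ≤ m ^ k ⊔ J s := le_sup_right
        _ = m ^ k ⊔ J n := h2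
        _ = _ := sup_comm _ _
  have hstab' : ∀ k : ℕ, ∃ s, k ≤ s ∧ ∀ n, J s ≤ J n ⊔ m ^ (l + k) := by
    intro k
    obtain ⟨s, hs⟩ := hstab (l + k) (by omega)
    exact ⟨max s k, le_max_right _ _, fun n => (hJ (le_max_left _ _)).trans (hs n)⟩
  choose S hSk hS using hstab'
  -- the sequence
  have hnext : ∀ k (a : {a : R // a ∈ J (S k) ∧ a ∉ m ^ l}),
      ∃ b : {b : R // b ∈ J (S (k+1)) ∧ b ∉ m ^ l}, (a : R) - b ∈ m ^ (l + k) := by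
    rintro k ⟨a, ha, hal⟩
    obtain ⟨b, hb, c, hc, hbc⟩ := Submodule.mem_sup.1 (hS k (S (k+1)) ha)
    refine ⟨⟨b, hb, fun hbl => hal ?_⟩, ?_⟩
    · rw [← hbc]
      exact Ideal.add_mem _ hbl (Ideal.pow_le_pow_right (by omega) hc)
    · change a - b ∈ _
      rw [← hbc, add_sub_cancel_left]; exact hc
  choose nx hnx using hnext
  obtain ⟨a0, ha0, ha0l⟩ := SetLike.not_le_iff_exists.1 (hcon (S 0))
  let seq : ∀ k, {a : R // a ∈ J (S k) ∧ a ∉ m ^ l} := fun k =>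
    Nat.rec ⟨a0, ha0, ha0l⟩ (fun k a => nx k a) k
  have hseq : ∀ k, ((seq k).1 - (seq (k+1)).1) ∈ m ^ (l + k) := fun k => hnx k (seq k)
  let c : AdicCompletion.AdicCauchySequence m R := AdicCompletion.AdicCauchySequence.mk m R
    (fun k => (seq k).1) (by
      intro k
      rw [SModEq.sub_mem, smul_eq_mul, Ideal.mul_top]
      exact Ideal.pow_le_pow_right (Nat.le_add_left k l) (hseq k))
  let A := AdicCompletion m R
  let z : A := AdicCompletion.mk m R c
  have hzk : ∀ k, AdicCompletion.evalₐ m k z = Ideal.Quotient.mk _ (seq k).1 := fun k => by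
    rw [AdicCompletion.evalₐ_mk]; rfl
  have hz0 : z ≠ 0 := by
    intro h
    have := hzk l
    rw [h, map_zero, eq_comm, Ideal.Quotient.eq_zero_iff_mem] at this
    exact (seq l).2.2 this
  have hAN : IsNoetherianRing A := adicCompletion_noetherian m
  have hnil : IsNilpotent z := by
    have hQm : Q ≤ m := hQ ▸ Ideal.le_radical
    refine isNilpotent_of_int (Q.map (algebraMap R A)) ?_ z ?_
    · rw [AdicCompletion.maximalIdeal_eq_map]; exact Ideal.map_mono hQm
    · intro n hn
      obtain ⟨k0, hk0⟩ := Ideal.exists_pow_le_of_le_radical_of_fg (I := m) (J := Q) hQ.ge (Ideal.fg_of_isNoetherianRing m)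
      let k := max (k0 * n) n
      have hmk : m ^ k ≤ Q ^ n := by
        calc m ^ k ≤ m ^ (k0 * n) := Ideal.pow_le_pow_right (le_max_left _ _)
          _ = (m ^ k0) ^ n := pow_mul _ _ _
          _ ≤ Q ^ n := Ideal.pow_right_mono hk0 n
      have hJn : (seq k).1 ∈ J n := hJ ((le_max_right _ _).trans (hSk k)) (seq k).2.1
      refine ⟨algebraMap R A (seq k).1, ?_, z - algebraMap R A (seq k).1, ?_, by ring⟩
      · rw [← Ideal.map_pow]; exact intClSet_map _ _ _ (hInt n hn _ hJn)
      · rw [← Ideal.map_pow]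
        refine Ideal.map_mono hmk ?_
        have hker : z - algebraMap R A (seq k).1 ∈ (AdicCompletion.eval m R k).ker := by
          rw [LinearMap.mem_ker, map_sub, sub_eq_zero]
          rfl
        rw [← AdicCompletion.pow_smul_top_eq_ker_eval (Ideal.fg_of_isNoetherianRing m),
          Ideal.smul_top_eq_map] at hker
        exact hker
  exact hz0 (hnil.eq_zero)

theorem eq_zero_of_isNilpotent_of_reduced (hred : IsReduced (AdicCompletion (maximalIdeal R) R))
    (r : R) (hr : IsNilpotent r) : r = 0 := by
  have h1 : algebraMap R (AdicCompletion (maximalIdeal R) R) r = 0 := (hr.map _).eq_zero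
  rw [AdicCompletion.algebraMap_apply] at h1
  exact AdicCompletion.of_injective (maximalIdeal R) R (by rw [map_zero]; exact h1)
end E3

section F1
variable {R : Type u} [CommRing R] [IsNoetherianRing R] [IsLocalRing R]
  {B : Type u} [CommRing B] [Algebra R B]

theorem contractedExt_eq_of_pos {d : ℕ} (x : Fin (d+1) → R) (Q : Ideal R)
    (hQx : Q = Ideal.span (Set.range x))
    (hred : IsReduced (AdicCompletion (maximalIdeal R) R))
    (hdag : SatisfiesDagger R (algebraMap R B))
    (hrad : Q.radical = maximalIdeal R)
    (hqB : QuasiReg fun i => algebraMap R B (x i)) (hqR : QuasiReg x) (eB : ℕ → ℤ)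
    (heB : HasHilbertSeries R (d+1) (fun n => contractedExt R (algebraMap R B) (Q ^ n)) eB)
    (h1 : eB 1 = 0) : contractedExt R (algebraMap R B) Q = Q := by
  set J : ℕ → Ideal R := fun n => contractedExt R (algebraMap R B) (Q ^ n) with hJdef
  have hJW : ∀ n, JW Q n (⊤ : Submodule R B) = J n := fun n => JW_top Q n
  have hanti : Antitone J := fun a b hab =>
    Ideal.comap_mono (Ideal.map_mono (Ideal.pow_le_pow_right hab))
  have hQJ : ∀ n, Q ^ n ≤ J n := fun n => by rw [← hJW]; exact pow_le_JW Q n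
  have hInt : ∀ n, 0 < n → ∀ r ∈ J n, r ∈ intClSet R (Q ^ n) := fun n hn r hr =>
    hdag (Q ^ n) (by rw [Ideal.radical_pow _ hn.ne', hrad]) hr
  have hchev := chevalley hred Q hrad J hanti hInt
  obtain ⟨e, he⟩ : ∃ e : ℕ, Module.length R (R ⧸ Q) = e := by
    have := isArtinian_quot_of_radical Q hrad
    have h2 : Module.length R (R ⧸ Q) ≠ ⊤ := Module.length_ne_top
    exact ⟨_, (ENat.coe_toNat h2).symm⟩
  obtain ⟨n0, hn0⟩ := J_step (B := B) x hqB e (by rw [← hQx]; exact he)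
  rw [← hQx] at hn0
  simp only [hJW] at hn0
  have hiter : ∀ k, ∀ n ≥ n0, J (n+1) ≤ Q * J n ⊔ J (n+1+k) := by
    intro k
    induction k with
    | zero => intro n _; exact le_sup_right
    | succ k ih =>
      intro n hn
      refine (ih n hn).trans (sup_le le_sup_left ?_)
      have h3 := hn0 (n+k) (by omega)
      rw [show n + 1 + k = n + k + 1 by ring]
      refine h3.trans (sup_le_sup (Ideal.mul_mono_right (hanti (by omega))) (le_of_eq (by ring_nf)))
  have hstep : ∀ n ≥ n0, J (n+1) ≤ Q * J n := by
    intro n hn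
    obtain ⟨k0, hk0⟩ := Ideal.exists_pow_le_of_le_radical_of_fg (I := maximalIdeal R) (J := Q ^ (n+1))
      (by rw [Ideal.radical_pow _ (Nat.succ_ne_zero n), hrad]) (Ideal.fg_of_isNoetherianRing _)
    obtain ⟨N, hN⟩ := hchev k0
    refine (hiter N n hn).trans (sup_le le_rfl ?_)
    calc J (n+1+N) ≤ J N := hanti (by omega)
      _ ≤ Q ^ (n+1) := hN.trans hk0
      _ = Q * Q ^ n := pow_succ' _ _
      _ ≤ Q * J n := Ideal.mul_mono_right (hQJ n)
  have hbound : ∀ k, J (n0 + k) ≤ Q ^ k := by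
    intro k
    induction k with
    | zero => simp
    | succ k ih =>
      refine (hstep (n0+k) (by omega)).trans ?_
      rw [pow_succ']; exact Ideal.mul_mono_right ih
  obtain ⟨N, hN⟩ := heB
  choose! p hp hpe using hN
  have hlen : ∀ n ≥ N, Module.length R (R ⧸ J (n+1)) = (p n : ℕ∞) := by
    intro n hn
    have h2 := hp n hn
    unfold moduleLength at h2
    rw [← Module.coe_length] at h2
    exact_mod_cast h2
  obtain ⟨f, hf⟩ : ∃ f : ℕ, Module.length R (R ⧸ J 1) = f := by
    have h2 : Module.length R (R ⧸ J 1) ≤ e := he ▸ length_quot_anti (by simpa using hQJ 1)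
    exact ⟨_, (ENat.coe_toNat (ne_top_of_le_ne_top (ENat.coe_ne_top e) h2)).symm⟩
  have hδ : (e : ℤ) - f ≤ 0 := by
    refine final_asymp d n0 N e (e - f) eB (fun n => (p n : ℤ)) h1 hpe ?_ ?_
    · intro n hn
      have h2 : ((n+1+d).choose (d+1) : ℕ) * (e : ℕ∞) ≤ p (n + n0) := by
        rw [← hlen (n+n0) (by omega), ← he, hQx]
        refine (le_length_pow x hqR (n+1)).trans ?_
        rw [← hQx]
        refine length_quot_anti ?_
        have := hbound (n+1)
        rwa [show n0 + (n+1) = n + n0 + 1 by ring] at this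
      have h3 : (n+1+d).choose (d+1) * e ≤ p (n + n0) := by exact_mod_cast h2
      rw [show n + 1 + d = n + d + 1 by ring] at h3
      have h4 : (((n+d+1).choose (d+1) * e : ℕ) : ℤ) ≤ (p (n + n0) : ℤ) := by exact_mod_cast h3
      push_cast at h4 ⊢
      linarith
    · intro n hn
      have hle : Q ^ n * J 1 ≤ J (n+1) := by
        simp only [hJdef, contractedExt]
        rw [Ideal.mul_le]
        intro a ha b hb
        rw [Ideal.mem_comap] at hb ⊢
        rw [map_mul, pow_succ, Ideal.map_mul]
        rw [pow_one] at hb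
        exact Ideal.mul_mem_mul (Ideal.mem_map_of_mem _ ha) hb
      have h2 : (p n : ℕ∞) ≤ ((n+d).choose (d+1) : ℕ) * (e : ℕ∞) + ((n+d).choose d : ℕ) * (f : ℕ∞) := by
        rw [← hlen n hn, ← hf, ← he]
        refine (length_quot_anti hle).trans ?_
        have h5 := length_pow_mul_le x (J 1) n
        have h6 := length_pow_le x n
        rw [← hQx] at h5 h6
        exact h5.trans (by gcongr)
      have h3 : p n ≤ (n+d).choose (d+1) * e + (n+d).choose d * f := by exact_mod_cast h2
      have h4 : (p n : ℤ) ≤ ((n+d).choose (d+1) : ℤ) * e + ((n+d).choose d : ℤ) * f := by exact_mod_cast h3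
      have h5 : ((n+d+1).choose (d+1) : ℤ) = (n+d).choose d + (n+d).choose (d+1) := by
        exact_mod_cast Nat.choose_succ_succ (n+d) d
      rw [h5]
      change (p n : ℤ) ≤ _
      linarith
  have hef : (e : ℕ∞) ≤ f := by
    have : e ≤ f := by omega
    exact_mod_cast this
  have hQ1 : Q ≤ J 1 := by simpa using hQJ 1
  have hJ1 : J 1 = contractedExt R (algebraMap R B) Q := by simp [hJdef]
  rw [← hJ1]
  refine le_antisymm ?_ hQ1
  have h7 := length_quot_eq_add hQ1
  rw [he, hf] at h7
  have h8 : Module.length R (LinearMap.ker (Submodule.factor hQ1)) = 0 := by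
    rw [h7] at hef
    generalize Module.length R (LinearMap.ker (Submodule.factor hQ1)) = L at hef
    induction L using ENat.recTopCoe with
    | top => rw [top_add] at hef; exact absurd (top_le_iff.1 hef) (ENat.coe_ne_top f)
    | coe L =>
      have : L + f ≤ f := by exact_mod_cast hef
      have : L = 0 := by omega
      rw [this]; rfl
  have h9 : Subsingleton (LinearMap.ker (Submodule.factor hQ1)) := Module.length_eq_zero_iff.1 h8
  intro a ha
  have hmem : Submodule.Quotient.mk a ∈ LinearMap.ker (Submodule.factor hQ1) := by
    rw [LinearMap.mem_ker]
    exact (Submodule.Quotient.mk_eq_zero _).2 ha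
  have h10 := congrArg Subtype.val (Subsingleton.elim (⟨_, hmem⟩ : LinearMap.ker (Submodule.factor hQ1)) 0)
  exact (Submodule.Quotient.mk_eq_zero _).1 h10
end F1

section G
theorem span_range_rev {R : Type*} [CommRing R] {d : ℕ} (x : Fin d → R) :
    Ideal.span (Set.range fun i : Fin d => x i.rev) = Ideal.span (Set.range x) := by
  congr 1
  ext r
  constructor
  · rintro ⟨i, rfl⟩; exact ⟨i.rev, rfl⟩
  · rintro ⟨i, rfl⟩; exact ⟨i.rev, by simp⟩

theorem ofList_ofFn {R : Type*} [CommRing R] {d : ℕ} (x : Fin d → R) :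
    Ideal.ofList (List.ofFn x) = Ideal.span (Set.range x) := by
  unfold Ideal.ofList
  congr 1
  ext r
  simp [List.mem_ofFn]

theorem weaklyRegular_of_sop {R : Type u} [CommRing R] [IsLocalRing R] [IsNoetherianRing R]
    (hCM : IsCohenMacaulayLocalRing R) {d : ℕ} (x : Fin d → R) (hx : IsSOP R x) :
    RingTheory.Sequence.IsWeaklyRegular R (List.ofFn x) := by
  obtain ⟨-, -, d', hd', ys, hlen, hys, hreg⟩ := hCM
  have hdd : d' = d := by
    have := hd'.symm.trans hx.1
    exact_mod_cast this
  refine weaklyRegular_of_depth ys (List.ofFn x) (by rw [hlen, hdd, List.length_ofFn]) ?_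
    hreg.toIsWeaklyRegular ?_ ?_
  · intro y hy
    have := hys y hy
    rwa [IsLocalRing.jacobson_eq_maximalIdeal _ bot_ne_top] at this
  · intro y hy
    obtain ⟨i, rfl⟩ := List.mem_ofFn.1 hy
    rw [← hx.2]
    exact Ideal.le_radical (Ideal.subset_span ⟨i, rfl⟩)
  · rw [ofList_ofFn, hx.2]
end G

/-- **Remark 3.10.** If `R` is Cohen–Macaulay, `R̂` is reduced, `B` is a balanced big
Cohen–Macaulay `R`-algebra satisfying (†) and `e₁^B(Q) = 0` for some parameter ideal
`Q`, then `Q^B = Q` and `R` is `BCM_B`-rational. -/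
theorem stmt15 (R : Type u) [CommRing R] [IsLocalRing R] [IsNoetherianRing R]
    (d : ℕ) (hd : ringKrullDim R = (d : WithBot ℕ∞))
    (hred : IsReduced (AdicCompletion (maximalIdeal R) R))
    (B : Type u) [CommRing B] [Algebra R B]
    (hB : IsBalancedBigCM R B) (hdag : SatisfiesDagger R (algebraMap R B))
    (hCM : IsCohenMacaulayLocalRing R)
    (Q : Ideal R) (hQ : IsParameterIdeal R Q)
    (eB : ℕ → ℤ)
    (heB : HasHilbertSeries R d (fun n => contractedExt R (algebraMap R B) (Q ^ n)) eB)
    (h1 : eB 1 = 0) :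
    contractedExt R (algebraMap R B) Q = Q ∧ IsBCMRational R B d := by
  obtain ⟨d', x, hx, hQx⟩ := hQ
  obtain rfl : d' = d := by
    have := hx.1.symm.trans hd
    exact_mod_cast this
  have hxr : IsSOP R (fun i : Fin d' => x i.rev) := ⟨hx.1, by rw [span_range_rev]; exact hx.2⟩
  have hrad : Q.radical = maximalIdeal R := hQx ▸ hx.2
  have key : contractedExt R (algebraMap R B) Q = Q := by
    cases d' with
    | zero =>
      refine le_antisymm ?_ Ideal.le_comap_map
      intro r hr
      obtain ⟨n, hn, a, ha, hra⟩ := hdag Q hrad hr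
      have hQ0 : Q = ⊥ := by rw [hQx]; simp
      have hr0 : r ^ n = 0 := by
        rw [Finset.sum_eq_zero, add_zero] at hra
        · exact hra
        · intro k hk
          have := ha k hk
          rw [Finset.mem_Icc] at hk
          rw [hQ0] at this
          have h2 : a k = 0 := by
            have := Ideal.pow_le_self (I := (⊥ : Ideal R)) (n := k) (by omega) this
            simpa using this
          rw [h2, zero_mul]
      rw [eq_zero_of_isNilpotent_of_reduced hred r ⟨n, hr0⟩]
      exact Q.zero_mem
    | succ d =>
      refine contractedExt_eq_of_pos x Q hQx hred hdag hrad ?_ ?_ eB heB h1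
      · exact quasiReg_of_regRev _ _ (regRev_of_isWeaklyRegular _
          (hB.1 _ _ hxr).toIsWeaklyRegular)
      · exact quasiReg_of_regRev _ _ (regRev_of_isWeaklyRegular _ (weaklyRegular_of_sop hCM _ hxr))
  refine ⟨key, hCM, ?_⟩
  have hofl : Ideal.ofList (List.ofFn x) = Q := by rw [ofList_ofFn, hQx]
  have hinj := localCohomology_map_injective_of_regular (maximalIdeal R) (List.ofFn x)
    (by rw [hofl, ← hrad]; exact Ideal.le_radical) (ModuleCat.of R R) (ModuleCat.of R B)
    (ModuleCat.ofHom (Algebra.linearMap R B)) (weaklyRegular_of_sop hCM x hx)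
    (by
      have h2 := (hB.1 _ _ hx).toIsWeaklyRegular
      rw [show (List.ofFn fun i => algebraMap R B (x i)) = (List.ofFn x).map (algebraMap R B) by
        rw [List.map_ofFn]; rfl] at h2
      exact (RingTheory.Sequence.isWeaklyRegular_map_algebraMap_iff B B (List.ofFn x)).1 h2)
    (by
      intro y hy
      rw [hofl] at hy ⊢
      have h3 : (algebraMap R B y) ∈ (Q • ⊤ : Submodule R B) := hy
      rw [Ideal.smul_top_eq_map] at h3
      have h4 : y ∈ contractedExt R (algebraMap R B) Q := h3
      rw [key] at h4
      have h5 : y ∈ (Q • ⊤ : Submodule R R) := by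
        rw [smul_eq_mul, Ideal.mul_top]; exact h4
      exact h5)
  rw [List.length_ofFn] at hinj
  exact hinj
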